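/- arXiv:2211.09714 — 4 statements merged into one kernel-verified Lean document; each statement's English description precedes it below -/
import Mathlib

section
/- Let m ∈ ℕ and let f_j ∈ S⁺ ∩ 𝒮(ℝ) for 0 ≤ j ≤ m. Then Σ_{j=0}^m x^j f_j(x) = 0 for all x ∈ ℝ if and only if f_j ≡ 0 for all 0 ≤ j ≤ m. -/
open MeasureTheory Filter

noncomputable section

/-- Schwartz function predicate. -/
def IsSchwartz (f : ℝ → ℝ) : Prop :=
  ContDiff ℝ (⊤ : ℕ∞) f ∧ ∀ k n : ℕ, ∃ C : ℝ, ∀ x : ℝ, |x| ^ k * |iteratedDeriv n f x| ≤ C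

/-- The strip −1 < Im z < 1 in ℂ. -/
def strip : Set ℂ := {z : ℂ | -1 < z.im ∧ z.im < 1}

/-- Membership in the space S⁺: bounded, smooth, derivative Schwartz, and
`f(x) = F(e^{√2 x})` for a holomorphic `F` on the strip whose power series on the unit
disk has only odd-degree terms. -/
def SPlus (f : ℝ → ℝ) : Prop :=
  ContDiff ℝ (⊤ : ℕ∞) f ∧ (∃ C : ℝ, ∀ x : ℝ, |f x| ≤ C) ∧ IsSchwartz (deriv f) ∧
  ∃ F : ℂ → ℂ, DifferentiableOn ℂ F strip ∧
    (∀ x : ℝ, F (Real.exp (Real.sqrt 2 * x)) = (f x : ℂ)) ∧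
    ∃ a : ℕ → ℝ, ∀ z : ℂ, ‖z‖ < 1 → HasSum (fun k => (a k : ℂ) * z ^ (2 * k + 1)) (F z)

/-- Membership in the space S⁻: bounded, smooth, derivative Schwartz, and
`g(x) = G(e^{−√2 x})` for a holomorphic `G` on the strip whose power series on the unit
disk has only even-degree terms of degree ≥ 2. -/
def SMinus (g : ℝ → ℝ) : Prop :=
  ContDiff ℝ (⊤ : ℕ∞) g ∧ (∃ C : ℝ, ∀ x : ℝ, |g x| ≤ C) ∧ IsSchwartz (deriv g) ∧
  ∃ G : ℂ → ℂ, DifferentiableOn ℂ G strip ∧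
    (∀ x : ℝ, G (Real.exp (-(Real.sqrt 2 * x))) = (g x : ℂ)) ∧
    ∃ b : ℕ → ℝ, ∀ z : ℂ, ‖z‖ < 1 → HasSum (fun k => (b k : ℂ) * z ^ (2 * (k + 1))) (G z)

open Topology

/-- A complex polynomial that tends to zero along some path to infinity is zero. -/
theorem Polynomial.eq_zero_of_tendsto_eval_zero {α : Type*} {l : Filter α} [l.NeBot]
    (P : Polynomial ℂ) {z : α → ℂ} (hz : Tendsto (fun x => ‖z x‖) l atTop)
    (hP : Tendsto (fun x => P.eval (z x)) l (𝓝 0)) : P = 0 := by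
  have hdeg : P.degree ≤ 0 := by
    by_contra! h
    exact not_tendsto_atTop_of_tendsto_nhds hP.norm (P.tendsto_norm_atTop h hz)
  rw [Polynomial.eq_C_of_degree_le_zero hdeg] at hP ⊢
  simp only [Polynomial.eval_C] at hP
  rw [tendsto_nhds_unique tendsto_const_nhds hP, Polynomial.C_0]

theorem tendsto_ofReal_exp_neg_atTop :
    Tendsto (fun y : ℝ => ((Real.exp (-y) : ℝ) : ℂ)) atTop (𝓝 0) := by
  have h := (Complex.continuous_ofReal.tendsto 0).comp Real.tendsto_exp_neg_atTop_nhds_zero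
  simpa only [Function.comp_def, Complex.ofReal_zero] using h

/-- If `G` is differentiable at `0`, then `G (e⁻ʸ)` converges to `G 0` faster than any power
of `y`. -/
theorem DifferentiableAt.tendsto_pow_mul_sub_exp_neg {G : ℂ → ℂ} (hG : DifferentiableAt ℂ G 0)
    (c : ℂ) (j : ℕ) :
    Tendsto (fun y : ℝ => (c * y) ^ j * (G (Real.exp (-y) : ℝ) - G 0)) atTop (𝓝 0) := by
  have hO : (fun y : ℝ => G (Real.exp (-y) : ℝ) - G 0) =O[atTop]
      fun y : ℝ => Real.exp (-y) := by
    have h := hG.isBigO_sub.comp_tendsto tendsto_ofReal_exp_neg_atTop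
    refine h.trans (Asymptotics.IsBigO.of_bound 1 (Eventually.of_forall fun y => ?_))
    simp only [Function.comp_apply, sub_zero, Complex.norm_real, one_mul, le_refl]
  have hpow : (fun y : ℝ => (c * y) ^ j) =O[atTop] fun y : ℝ => y ^ j := by
    refine Asymptotics.IsBigO.of_bound (‖c‖ ^ j) (Eventually.of_forall fun y => ?_)
    simp only [norm_pow, norm_mul, Complex.norm_real, mul_pow, le_refl]
  exact (hpow.mul hO).trans_tendsto (Real.tendsto_pow_mul_exp_neg_atTop_nhds_zero j)

/-- If a polynomial in `y` whose coefficients are functions of `e⁻ʸ`, differentiable at `0`,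
vanishes for large `y`, then all coefficients vanish at `0`. -/
theorem eq_zero_of_sum_pow_mul_exp_neg_eq_zero {m : ℕ} {G : ℕ → ℂ → ℂ} {c : ℂ} (hc : c ≠ 0)
    (hG : ∀ j ≤ m, DifferentiableAt ℂ (G j) 0)
    (h : ∀ᶠ y : ℝ in atTop,
      ∑ j ∈ Finset.range (m + 1), (c * y) ^ j * G j (Real.exp (-y) : ℝ) = 0) :
    ∀ j ≤ m, G j 0 = 0 := by
  set P : Polynomial ℂ := ∑ j ∈ Finset.range (m + 1), Polynomial.monomial j (G j 0) with hPdef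
  have hcy : Tendsto (fun y : ℝ => ‖c * y‖) atTop atTop := by
    simp only [norm_mul, Complex.norm_real]
    exact tendsto_norm_atTop_atTop.const_mul_atTop (norm_pos_iff.mpr hc)
  have hlim : Tendsto (fun y : ℝ => P.eval (c * y)) atTop (𝓝 0) := by
    have hsum : Tendsto (fun y : ℝ => ∑ j ∈ Finset.range (m + 1),
        (c * y) ^ j * (G j (Real.exp (-y) : ℝ) - G j 0)) atTop
        (𝓝 (∑ _j ∈ Finset.range (m + 1), (0 : ℂ))) :=
      tendsto_finsetSum _ fun j hj =>
        (hG j (Finset.mem_range_succ_iff.mp hj)).tendsto_pow_mul_sub_exp_neg c j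
    have hneg := hsum.neg
    simp only [Finset.sum_const_zero, neg_zero] at hneg
    refine hneg.congr' ?_
    filter_upwards [h] with y hy
    simp only [mul_sub, Finset.sum_sub_distrib, hy, hPdef, Polynomial.eval_finsetSum,
      Polynomial.eval_monomial, zero_sub, neg_neg]
    exact Finset.sum_congr rfl fun j _ => mul_comm _ _
  have hP := P.eq_zero_of_tendsto_eval_zero hcy hlim
  intro j hj
  have hcoeff : P.coeff j = G j 0 := by
    simp only [hPdef, Polynomial.finsetSum_coeff, Polynomial.coeff_monomial]
    rw [Finset.sum_ite_eq' (Finset.range (m + 1)) j, if_pos (Finset.mem_range_succ_iff.mpr hj)]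
  rw [← hcoeff, hP, Polynomial.coeff_zero]

/-- If a polynomial in `y` whose coefficients are functions of `e⁻ʸ`, analytic at `0`,
vanishes for large `y`, then all coefficients vanish to infinite order at `0`. -/
theorem eventually_eq_zero_of_sum_pow_mul_exp_neg_eq_zero {m : ℕ} {F : ℕ → ℂ → ℂ} {c : ℂ}
    (hc : c ≠ 0) (hF : ∀ j ≤ m, AnalyticAt ℂ (F j) 0)
    (h : ∀ᶠ y : ℝ in atTop,
      ∑ j ∈ Finset.range (m + 1), (c * y) ^ j * F j (Real.exp (-y) : ℝ) = 0) :
    ∀ j ≤ m, ∀ᶠ z in 𝓝 0, F j z = 0 := by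
  have horder : ∀ n : ℕ, ∀ j ≤ m, (n : ℕ∞) ≤ analyticOrderAt (F j) 0 := by
    intro n
    induction n with
    | zero => simp
    | succ n ih =>
      have hfac : ∀ j, ∃ g : ℂ → ℂ, j ≤ m →
          AnalyticAt ℂ g 0 ∧ ∀ᶠ z in 𝓝 0, F j z = (z - 0) ^ n • g z := by
        intro j
        by_cases hj : j ≤ m
        · obtain ⟨g, hg⟩ := (natCast_le_analyticOrderAt (hF j hj)).mp (ih j hj)
          exact ⟨g, fun _ => hg⟩
        · exact ⟨0, fun hj' => absurd hj' hj⟩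
      choose g hg using hfac
      have hg0 : ∀ j ≤ m, g j 0 = 0 := by
        refine eq_zero_of_sum_pow_mul_exp_neg_eq_zero hc
          (fun j hj => (hg j hj).1.differentiableAt) ?_
        have hev : ∀ᶠ y : ℝ in atTop, ∀ j ∈ Finset.range (m + 1),
            F j (Real.exp (-y) : ℝ) =
              (((Real.exp (-y) : ℝ) : ℂ) - 0) ^ n • g j (Real.exp (-y) : ℝ) := by
          rw [Filter.eventually_all_finset]
          exact fun j hj => tendsto_ofReal_exp_neg_atTop.eventually
            (hg j (Finset.mem_range_succ_iff.mp hj)).2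
        filter_upwards [h, hev] with y hy hFy
        have hne : ((Real.exp (-y) : ℝ) : ℂ) ^ n ≠ 0 :=
          pow_ne_zero _ (Complex.ofReal_ne_zero.mpr (Real.exp_ne_zero _))
        refine (mul_eq_zero.mp ?_).resolve_left hne
        rw [← hy, Finset.mul_sum]
        refine Finset.sum_congr rfl fun j hj => ?_
        rw [hFy j hj, sub_zero, smul_eq_mul]
        ring
      intro j hj
      obtain ⟨hga, hgF⟩ := hg j hj
      obtain ⟨k, hka, hk⟩ := (natCast_le_analyticOrderAt (n := 1) hga).mp (by
        rw [Nat.cast_one, Order.one_le_iff_ne_zero]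
        exact hga.analyticOrderAt_ne_zero.mpr (hg0 j hj))
      refine (natCast_le_analyticOrderAt (hF j hj)).mpr ⟨k, hka, ?_⟩
      filter_upwards [hgF, hk] with z hz hkz
      rw [hz, hkz, smul_smul, pow_one, ← pow_succ]
  intro j hj
  exact analyticOrderAt_eq_top.mp (ENat.eq_top_iff_forall_ge.mpr fun n => horder n j hj)

theorem isOpen_strip : IsOpen strip :=
  (isOpen_lt continuous_const Complex.continuous_im).inter
    (isOpen_lt Complex.continuous_im continuous_const)

theorem isPreconnected_strip : IsPreconnected strip :=
  ((convex_halfSpace_im_gt (-1)).inter (convex_halfSpace_im_lt 1)).isPreconnected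

theorem ofReal_mem_strip (x : ℝ) : (x : ℂ) ∈ strip := by
  simp [strip]

/-- Linear independence of the spaces S^{+,j}: a sum Σ_{j=0}^m x^j f_j(x) with
f_j ∈ S⁺ ∩ 𝒮(ℝ) vanishes identically iff every f_j vanishes identically. -/
theorem stmt6 (m : ℕ) (f : ℕ → ℝ → ℝ)
    (hf : ∀ j, j ≤ m → SPlus (f j) ∧ IsSchwartz (f j)) :
    (∀ x : ℝ, ∑ j ∈ Finset.range (m + 1), x ^ j * f j x = 0) ↔
      (∀ j, j ≤ m → ∀ x : ℝ, f j x = 0) := by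
  refine ⟨fun h => ?_, fun h x => Finset.sum_eq_zero fun j hj => by
    rw [h j (Finset.mem_range_succ_iff.mp hj) x, mul_zero]⟩
  have hex : ∀ j, ∃ F : ℂ → ℂ, j ≤ m → DifferentiableOn ℂ F strip ∧
      ∀ x : ℝ, F (Real.exp (Real.sqrt 2 * x)) = (f j x : ℂ) := by
    intro j
    by_cases hj : j ≤ m
    · obtain ⟨⟨-, -, -, F, hF, hFf, -⟩, -⟩ := hf j hj
      exact ⟨F, fun _ => ⟨hF, hFf⟩⟩
    · exact ⟨0, fun hj' => absurd hj' hj⟩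
  choose F hF using hex
  have hzero : (0 : ℂ) ∈ strip := by exact_mod_cast ofReal_mem_strip 0
  have hana : ∀ j ≤ m, AnalyticOnNhd ℂ (F j) strip := fun j hj =>
    (hF j hj).1.analyticOnNhd isOpen_strip
  have hsqrt : Real.sqrt 2 ≠ 0 := by positivity
  have hc : ((-(Real.sqrt 2)⁻¹ : ℝ) : ℂ) ≠ 0 :=
    Complex.ofReal_ne_zero.mpr (neg_ne_zero.mpr (inv_ne_zero hsqrt))
  have hlocal := eventually_eq_zero_of_sum_pow_mul_exp_neg_eq_zero hc
    (fun j hj => hana j hj 0 hzero) (Eventually.of_forall fun y => by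
      rw [← Complex.ofReal_zero, ← h (-(Real.sqrt 2)⁻¹ * y), Complex.ofReal_sum]
      refine Finset.sum_congr rfl fun j hj => ?_
      have hy : Real.sqrt 2 * (-(Real.sqrt 2)⁻¹ * y) = -y := by field_simp
      rw [Complex.ofReal_mul, ← (hF j (Finset.mem_range_succ_iff.mp hj)).2, hy]
      push_cast
      rfl)
  intro j hj x
  have hFz := (hana j hj).eqOn_zero_of_preconnected_of_eventuallyEq_zero
    isPreconnected_strip hzero (hlocal j hj) (ofReal_mem_strip (Real.exp (Real.sqrt 2 * x)))
  rw [(hF j hj).2 x] at hFz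
  exact Complex.ofReal_eq_zero.mp hFz

end
end

section
/- Let x₁, x₂ ∈ ℝ with ζ = x₂ − x₁ > 0, and let m > 0. (i) For α, β > 0 with α ≠ β, there is C(α,β,m) > 0 such that ∫_ℝ |x−x₁|^m e^{−α(x−x₁)₊} e^{−β(x₂−x)₊} dx ≤ C(α,β,m) max((1+ζ^m) e^{−αζ}, e^{−βζ}). (ii) For any α > 0, there is C(α,m) > 0 such that ∫_ℝ |x−x₁|^m e^{−α(x−x₁)₊} e^{−α(x₂−x)₊} dx ≤ C(α,m)(1+ζ^{m+1}) e^{−αζ}. -/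
open MeasureTheory Filter

noncomputable section

/-- The weight `|y| ^ m * exp (-c |y|)`. -/
def absExpWeight (m c y : ℝ) : ℝ := |y| ^ m * Real.exp (-(c * |y|))

theorem absExpWeight_nonneg (m c y : ℝ) : 0 ≤ absExpWeight m c y := by
  unfold absExpWeight; positivity

theorem absExpWeight_zero_left (c y : ℝ) : absExpWeight 0 c y = Real.exp (-(c * |y|)) := by
  simp [absExpWeight]

theorem integrable_absExpWeight {m c : ℝ} (hm : -1 < m) (hc : 0 < c) :
    Integrable (absExpWeight m c) := by
  have h := integrableOn_rpow_mul_exp_neg_mul_rpow (p := 1) hm one_pos hc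
  have h' : IntegrableOn (fun y : ℝ => y ^ m * Real.exp (-(c * y))) (Set.Ioi 0) := by
    simpa using h
  have hpos : IntegrableOn (absExpWeight m c) (Set.Ioi 0) :=
    h'.congr_fun (fun y hy => by simp [absExpWeight, abs_of_pos (Set.mem_Ioi.1 hy)])
      measurableSet_Ioi
  have hneg : IntegrableOn (absExpWeight m c) (Set.Iic 0) := by
    have h_refl := IntegrableOn.comp_neg_Iic (c := 0) (μ := volume) (f := absExpWeight m c) (by
      rwa [neg_zero, integrableOn_Ici_iff_integrableOn_Ioi])
    exact h_refl.congr_fun (fun y _ => by simp [absExpWeight]) measurableSet_Iic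
  exact integrableOn_univ.1 (Set.Iic_union_Ioi (a := (0 : ℝ)) ▸ hneg.union hpos)

theorem integral_absExpWeight_nonneg (m c : ℝ) : 0 ≤ ∫ y, absExpWeight m c y :=
  integral_nonneg (absExpWeight_nonneg m c)

theorem add_rpow_le_two_rpow_mul {a b m : ℝ} (ha : 0 ≤ a) (hb : 0 ≤ b) (hm : 0 ≤ m) :
    (a + b) ^ m ≤ 2 ^ m * (a ^ m + b ^ m) := by
  have hmax : (a + b) ^ m ≤ (2 * max a b) ^ m := by
    gcongr
    linarith [le_max_left a b, le_max_right a b]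
  refine hmax.trans ?_
  rw [Real.mul_rpow two_pos.le (ha.trans (le_max_left a b))]
  gcongr
  rcases max_choice a b with h | h <;> rw [h] <;>
    linarith [Real.rpow_nonneg ha m, Real.rpow_nonneg hb m]

/-- Bound on the interaction integral in terms of a majorant `M` of the integrand between the two
centres `0` and `z`; the two tails are bounded by moments of exponential weights. -/
theorem integral_interaction_le {α β m z : ℝ} (hα : 0 < α) (hβ : 0 < β) (hm : 0 < m) (hz : 0 < z)
    {M : ℝ → ℝ} (hM : Integrable M) (hM_nonneg : ∀ y, 0 ≤ M y)
    (hle : ∀ y, 0 ≤ y → y ≤ z →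
      y ^ m * Real.exp (-(α * y)) * Real.exp (-(β * (z - y))) ≤ M y) :
    (∫ y : ℝ, |y| ^ m * Real.exp (-(α * max y 0)) * Real.exp (-(β * max (z - y) 0))) ≤
      Real.exp (-(β * z)) * (∫ y, absExpWeight m β y) +
        2 ^ m * Real.exp (-(α * z)) *
          (z ^ m * (∫ y, absExpWeight 0 α y) + ∫ y, absExpWeight m α y) + ∫ y, M y := by
  have hl : Integrable fun y => Real.exp (-(β * z)) * absExpWeight m β y :=
    (integrable_absExpWeight (by linarith) hβ).const_mul _
  have hr0 : Integrable fun y => z ^ m * absExpWeight 0 α (y - z) :=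
    ((integrable_absExpWeight (by norm_num) hα).comp_sub_right z).const_mul _
  have hrm : Integrable fun y => absExpWeight m α (y - z) :=
    (integrable_absExpWeight (by linarith) hα).comp_sub_right z
  have hr : Integrable fun y => 2 ^ m * Real.exp (-(α * z)) *
      (z ^ m * absExpWeight 0 α (y - z) + absExpWeight m α (y - z)) :=
    (hr0.add hrm).const_mul _
  have hl_nonneg (y : ℝ) : 0 ≤ Real.exp (-(β * z)) * absExpWeight m β y :=
    mul_nonneg (Real.exp_pos _).le (absExpWeight_nonneg _ _ _)
  have hr_nonneg (y : ℝ) : 0 ≤ 2 ^ m * Real.exp (-(α * z)) *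
      (z ^ m * absExpWeight 0 α (y - z) + absExpWeight m α (y - z)) := by
    have h0 := absExpWeight_nonneg 0 α (y - z)
    have h1 := absExpWeight_nonneg m α (y - z)
    positivity
  calc
    _ ≤ ∫ y, (Real.exp (-(β * z)) * absExpWeight m β y + 2 ^ m * Real.exp (-(α * z)) *
          (z ^ m * absExpWeight 0 α (y - z) + absExpWeight m α (y - z)) + M y) := by
      refine integral_mono_of_nonneg (.of_forall fun y => by dsimp only; positivity)
        ((hl.add hr).add hM) (.of_forall fun y => ?_)
      dsimp only
      rcases le_total y 0 with hy | hy
      · refine le_add_of_le_of_nonneg (le_add_of_le_of_nonneg ?_ (hr_nonneg y)) (hM_nonneg y)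
        rw [max_eq_right hy, max_eq_left (by linarith), absExpWeight, abs_of_nonpos hy,
          show -(β * (z - y)) = -(β * z) + -(β * -y) by ring, Real.exp_add]
        simp only [mul_zero, neg_zero, Real.exp_zero]
        apply le_of_eq
        ring
      rcases le_total y z with hyz | hyz
      · refine le_add_of_nonneg_of_le (add_nonneg (hl_nonneg y) (hr_nonneg y)) ?_
        rw [max_eq_left hy, max_eq_left (by linarith), abs_of_nonneg hy]
        exact hle y hy hyz
      · refine le_add_of_le_of_nonneg (le_add_of_nonneg_of_le (hl_nonneg y) ?_) (hM_nonneg y)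
        have hs : 0 ≤ y - z := by linarith
        have hpow := add_rpow_le_two_rpow_mul hz.le hs hm.le
        rw [show z + (y - z) = y by ring] at hpow
        rw [max_eq_left hy, max_eq_right (by linarith), abs_of_nonneg hy, absExpWeight_zero_left,
          absExpWeight, abs_of_nonneg hs]
        simp only [mul_zero, neg_zero, Real.exp_zero, mul_one]
        calc
          _ ≤ 2 ^ m * (z ^ m + (y - z) ^ m) * Real.exp (-(α * y)) := by gcongr
          _ = _ := by
            rw [show -(α * y) = -(α * z) + -(α * (y - z)) by ring, Real.exp_add]
            ring
    _ = _ := by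
      rw [integral_add (by exact hl.add hr) hM, integral_add hl hr, integral_const_mul, integral_const_mul,
        integral_add hr0 hrm, integral_const_mul, integral_sub_right_eq_self (absExpWeight 0 α),
        integral_sub_right_eq_self (absExpWeight m α)]

theorem integral_interaction_translate (α β m x₁ x₂ : ℝ) :
    (∫ x : ℝ, |x - x₁| ^ m * Real.exp (-(α * max (x - x₁) 0))
        * Real.exp (-(β * max (x₂ - x) 0))) =
      ∫ y : ℝ, |y| ^ m * Real.exp (-(α * max y 0)) *
        Real.exp (-(β * max (x₂ - x₁ - y) 0)) := by
  rw [← integral_sub_right_eq_self (fun y : ℝ => |y| ^ m * Real.exp (-(α * max y 0)) *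
    Real.exp (-(β * max (x₂ - x₁ - y) 0))) x₁]
  simp only [sub_sub_sub_cancel_right]

theorem integral_interaction_le_of_lt {α β m z : ℝ} (hα : 0 < α) (hαβ : α < β) (hm : 0 < m)
    (hz : 0 < z) :
    (∫ y : ℝ, |y| ^ m * Real.exp (-(α * max y 0)) * Real.exp (-(β * max (z - y) 0))) ≤
      Real.exp (-(β * z)) * (∫ y, absExpWeight m β y) +
        2 ^ m * Real.exp (-(α * z)) *
          (z ^ m * (∫ y, absExpWeight 0 α y) + ∫ y, absExpWeight m α y) +
        z ^ m * Real.exp (-(α * z)) * ∫ y, absExpWeight 0 (β - α) y := by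
  have h := integral_interaction_le hα (hα.trans hαβ) hm hz
    (M := fun y => z ^ m * Real.exp (-(α * z)) * absExpWeight 0 (β - α) (y - z))
    (((integrable_absExpWeight (by norm_num) (sub_pos.2 hαβ)).comp_sub_right z).const_mul _)
    (fun y => mul_nonneg (by positivity) (absExpWeight_nonneg _ _ _)) fun y hy hyz => by
      rw [absExpWeight_zero_left, abs_of_nonpos (by linarith), mul_assoc, mul_assoc,
        ← Real.exp_add, ← Real.exp_add]
      refine mul_le_mul (by gcongr) (le_of_eq ?_) (Real.exp_pos _).le (by positivity)
      ring_nf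
  rwa [integral_const_mul, integral_sub_right_eq_self (absExpWeight 0 (β - α))] at h

theorem integral_interaction_le_of_gt {α β m z : ℝ} (hβ : 0 < β) (hβα : β < α) (hm : 0 < m)
    (hz : 0 < z) :
    (∫ y : ℝ, |y| ^ m * Real.exp (-(α * max y 0)) * Real.exp (-(β * max (z - y) 0))) ≤
      Real.exp (-(β * z)) * (∫ y, absExpWeight m β y) +
        2 ^ m * Real.exp (-(α * z)) *
          (z ^ m * (∫ y, absExpWeight 0 α y) + ∫ y, absExpWeight m α y) +
        Real.exp (-(β * z)) * ∫ y, absExpWeight m (α - β) y := by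
  have h := integral_interaction_le (hβ.trans hβα) hβ hm hz
    (M := fun y => Real.exp (-(β * z)) * absExpWeight m (α - β) y)
    ((integrable_absExpWeight (by linarith) (sub_pos.2 hβα)).const_mul _)
    (fun y => mul_nonneg (by positivity) (absExpWeight_nonneg _ _ _)) fun y hy _ => by
      rw [absExpWeight, abs_of_nonneg hy, mul_left_comm, mul_assoc, ← Real.exp_add,
        ← Real.exp_add]
      gcongr _ * ?_
      apply le_of_eq
      ring_nf
  rwa [integral_const_mul] at h

theorem integral_interaction_le_of_eq {α m z : ℝ} (hα : 0 < α) (hm : 0 < m) (hz : 0 < z) :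
    (∫ y : ℝ, |y| ^ m * Real.exp (-(α * max y 0)) * Real.exp (-(α * max (z - y) 0))) ≤
      Real.exp (-(α * z)) * (∫ y, absExpWeight m α y) +
        2 ^ m * Real.exp (-(α * z)) *
          (z ^ m * (∫ y, absExpWeight 0 α y) + ∫ y, absExpWeight m α y) +
        z ^ (m + 1) * Real.exp (-(α * z)) := by
  have h := integral_interaction_le hα hα hm hz
    (M := (Set.Icc 0 z).indicator fun _ => z ^ m * Real.exp (-(α * z)))
    ((integrable_indicator_iff measurableSet_Icc).2 (integrableOn_const (by simp)))
    (fun y => Set.indicator_nonneg (fun _ _ => by positivity) y) fun y hy hyz => by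
      rw [Set.indicator_of_mem (Set.mem_Icc.2 ⟨hy, hyz⟩), mul_assoc, ← Real.exp_add]
      refine mul_le_mul (by gcongr) (le_of_eq ?_) (Real.exp_pos _).le (by positivity)
      ring_nf
  rw [integral_indicator_const _ measurableSet_Icc, Real.volume_real_Icc_of_le hz.le,
    smul_eq_mul] at h
  rw [Real.rpow_add_one hz.ne']
  linarith

theorem exp_le_max_bounds (α β m : ℝ) {z : ℝ} (hz : 0 < z) :
    let X := max ((1 + z ^ m) * Real.exp (-(α * z))) (Real.exp (-(β * z)))
    0 ≤ X ∧ Real.exp (-(β * z)) ≤ X ∧ Real.exp (-(α * z)) ≤ X ∧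
      z ^ m * Real.exp (-(α * z)) ≤ X := by
  have hpow : 0 ≤ z ^ m := by positivity
  refine ⟨le_max_of_le_right (Real.exp_pos _).le, le_max_right _ _, le_max_of_le_left ?_,
    le_max_of_le_left ?_⟩
  · exact le_mul_of_one_le_left (Real.exp_pos _).le (by linarith)
  · gcongr
    linarith

/-- Interaction integral estimates (Lemma 2.1). Here `max y 0` is the positive part `y₊`,
and powers with real exponents are `Real.rpow`. -/
theorem stmt10 :
    (∀ α β m : ℝ, 0 < α → 0 < β → α ≠ β → 0 < m →
      ∃ C : ℝ, 0 < C ∧ ∀ x₁ x₂ : ℝ, 0 < x₂ - x₁ →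
        (∫ x : ℝ, |x - x₁| ^ m * Real.exp (-(α * max (x - x₁) 0))
            * Real.exp (-(β * max (x₂ - x) 0)))
          ≤ C * max ((1 + (x₂ - x₁) ^ m) * Real.exp (-(α * (x₂ - x₁))))
              (Real.exp (-(β * (x₂ - x₁))))) ∧
    (∀ α m : ℝ, 0 < α → 0 < m →
      ∃ C : ℝ, 0 < C ∧ ∀ x₁ x₂ : ℝ, 0 < x₂ - x₁ →
        (∫ x : ℝ, |x - x₁| ^ m * Real.exp (-(α * max (x - x₁) 0))
            * Real.exp (-(α * max (x₂ - x) 0)))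
          ≤ C * ((1 + (x₂ - x₁) ^ (m + 1)) * Real.exp (-(α * (x₂ - x₁))))) := by
  constructor
  · intro α β m hα hβ hne hm
    have hA := integral_absExpWeight_nonneg m β
    have hB := integral_absExpWeight_nonneg 0 α
    have hD := integral_absExpWeight_nonneg m α
    rcases lt_or_gt_of_ne hne with hlt | hlt
    · have hE := integral_absExpWeight_nonneg 0 (β - α)
      refine ⟨(∫ y, absExpWeight m β y) + 2 ^ m * ((∫ y, absExpWeight 0 α y) +
        ∫ y, absExpWeight m α y) + (∫ y, absExpWeight 0 (β - α) y) + 1, by positivity,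
        fun x₁ x₂ hz => ?_⟩
      rw [integral_interaction_translate]
      refine (integral_interaction_le_of_lt hα hlt hm hz).trans ?_
      generalize x₂ - x₁ = z at *
      obtain ⟨h1, h2, h3, h4⟩ := exp_le_max_bounds α β m hz
      set X := max ((1 + z ^ m) * Real.exp (-(α * z))) (Real.exp (-(β * z)))
      calc
        _ = Real.exp (-(β * z)) * (∫ y, absExpWeight m β y) +
            2 ^ m * ((z ^ m * Real.exp (-(α * z))) * (∫ y, absExpWeight 0 α y) +
              Real.exp (-(α * z)) * ∫ y, absExpWeight m α y) +
            z ^ m * Real.exp (-(α * z)) * ∫ y, absExpWeight 0 (β - α) y := by ring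
        _ ≤ X * (∫ y, absExpWeight m β y) +
            2 ^ m * (X * (∫ y, absExpWeight 0 α y) + X * ∫ y, absExpWeight m α y) +
            X * ∫ y, absExpWeight 0 (β - α) y := by gcongr
        _ ≤ _ := by linarith
    · have hE := integral_absExpWeight_nonneg m (α - β)
      refine ⟨(∫ y, absExpWeight m β y) + 2 ^ m * ((∫ y, absExpWeight 0 α y) +
        ∫ y, absExpWeight m α y) + (∫ y, absExpWeight m (α - β) y) + 1, by positivity,
        fun x₁ x₂ hz => ?_⟩
      rw [integral_interaction_translate]
      refine (integral_interaction_le_of_gt hβ hlt hm hz).trans ?_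
      generalize x₂ - x₁ = z at *
      obtain ⟨h1, h2, h3, h4⟩ := exp_le_max_bounds α β m hz
      set X := max ((1 + z ^ m) * Real.exp (-(α * z))) (Real.exp (-(β * z)))
      calc
        _ = Real.exp (-(β * z)) * (∫ y, absExpWeight m β y) +
            2 ^ m * ((z ^ m * Real.exp (-(α * z))) * (∫ y, absExpWeight 0 α y) +
              Real.exp (-(α * z)) * ∫ y, absExpWeight m α y) +
            Real.exp (-(β * z)) * ∫ y, absExpWeight m (α - β) y := by ring
        _ ≤ X * (∫ y, absExpWeight m β y) +
            2 ^ m * (X * (∫ y, absExpWeight 0 α y) + X * ∫ y, absExpWeight m α y) +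
            X * ∫ y, absExpWeight m (α - β) y := by gcongr
        _ ≤ _ := by linarith
  · intro α m hα hm
    have hB := integral_absExpWeight_nonneg 0 α
    have hD := integral_absExpWeight_nonneg m α
    refine ⟨(∫ y, absExpWeight m α y) + 2 ^ m * ((∫ y, absExpWeight 0 α y) +
      ∫ y, absExpWeight m α y) + 1, by positivity, fun x₁ x₂ hz => ?_⟩
    rw [integral_interaction_translate]
    refine (integral_interaction_le_of_eq hα hm hz).trans ?_
    generalize x₂ - x₁ = z at *
    have hpos : 0 ≤ z ^ (m + 1) := by positivity
    have hone : 1 ≤ 1 + z ^ (m + 1) := by linarith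
    have hpow : z ^ m ≤ 1 + z ^ (m + 1) := by
      rcases le_total z 1 with h | h
      · linarith [Real.rpow_le_one hz.le h hm.le]
      · linarith [Real.rpow_le_rpow_of_exponent_le h (show m ≤ m + 1 by linarith)]
    have hlast : z ^ (m + 1) ≤ 1 + z ^ (m + 1) := by linarith
    calc
      _ = Real.exp (-(α * z)) * (1 * (∫ y, absExpWeight m α y) +
          2 ^ m * (z ^ m * (∫ y, absExpWeight 0 α y) + 1 * ∫ y, absExpWeight m α y) +
          z ^ (m + 1)) := by ring
      _ ≤ Real.exp (-(α * z)) * ((1 + z ^ (m + 1)) * (∫ y, absExpWeight m α y) +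
          2 ^ m * ((1 + z ^ (m + 1)) * (∫ y, absExpWeight 0 α y) +
            (1 + z ^ (m + 1)) * ∫ y, absExpWeight m α y) + (1 + z ^ (m + 1))) := by gcongr
      _ = _ := by ring

end
end

section
/- Let n₁ ∈ ℕ, n₂ ∈ ℕ∪{0}, and for 0 < v < 1 let r_v : ℝ → ℝ be smooth with |d^l r_v(t)/dt^l| ≤ C(l) v^{n₁+l} ln(1/v)^{n₂} for all l ∈ ℕ∪{0}, when 0 < v is sufficiently small. For m₁ ∈ ℕ, m₂ ∈ ℕ∪{0}, m₃ ∈ ℤ, set p(v,t) = (1 − ḋ_v(t)²/4)^{m₃/2} exp(−m₁√2 (d_v(t)+r_v(t)) / (1 − ḋ_v(t)²/4)^{m₂/2}) − e^{−m₁√2 d_v(t)}. Then, for 0 < v sufficiently small and every l ∈ ℕ∪{0}: (i) if m₂ = m₃ = 0, |∂ₜ^l p(v,t)| ≤ C(m₁,l) v^{2m₁+n₁+l}(ln(1/v)+|t|v)^{n₂} e^{−2√2|t|v}; (ii) if m₃ ≠ 0 and m₂ = 0, |∂ₜ^l p(v,t)| ≤ C(m₁,l) max(v^{2m₁+2+l},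 v^{2m₁+n₁+l}(ln(1/v)+|t|v)^{n₂}) e^{−2√2|t|v}; (iii) if m₂ ≠ 0, |∂ₜ^l p(v,t)| ≤ C(m₁,l) max(v^{2m₁+2+l}(|t|v+ln(1/v)), v^{2m₁+n₁+l}(|t|v+ln(1/v))^{n₂}) e^{−2√2|t|v}. -/
open MeasureTheory Filter

noncomputable section

/-- `d_v(t) = (1/√2) ln((8/v²) cosh²(√2 v t))`. -/
def dv (v t : ℝ) : ℝ := (1 / Real.sqrt 2) * Real.log ((8 / v ^ 2) * Real.cosh (Real.sqrt 2 * v * t) ^ 2)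

/-- The Lorentz factor `√(1 − ḋ_v(t)²/4)`. -/
def gamv (v t : ℝ) : ℝ := Real.sqrt (1 - (deriv (dv v) t) ^ 2 / 4)

/-- `w₀(t,x) = (x − d_v(t)/2)/√(1 − ḋ_v(t)²/4)`. -/
def w0 (v t x : ℝ) : ℝ := (x - dv v t / 2) / gamv v t

/-- The function `p(v,t)` of Lemma 3.4 (real exponents use `Real.rpow`). -/
def pfun (r : ℝ → ℝ → ℝ) (m₁ m₂ : ℕ) (m₃ : ℤ) (v t : ℝ) : ℝ :=
  (1 - (deriv (dv v) t) ^ 2 / 4) ^ ((m₃ : ℝ) / 2)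
      * Real.exp (-((m₁ : ℝ) * Real.sqrt 2 * (dv v t + r v t))
          / (1 - (deriv (dv v) t) ^ 2 / 4) ^ ((m₂ : ℝ) / 2))
    - Real.exp (-((m₁ : ℝ) * Real.sqrt 2 * dv v t))

/-- The family `f v`, smooth for small `v > 0`, satisfies `|∂ₜˡ f v t| ≤ C vˡ φ v t` for `l ≤ n`. -/
def SymbolBound (n : ℕ) (φ f : ℝ → ℝ → ℝ) : Prop :=
  ∃ C : ℝ, 0 < C ∧ ∀ᶠ v in nhdsWithin (0 : ℝ) (Set.Ioi 0), ContDiff ℝ (⊤ : ℕ∞) (f v) ∧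
    ∀ l ≤ n, ∀ t, |iteratedDeriv l (f v) t| ≤ C * v ^ l * φ v t

/-- Uniform pointwise domination `|f v t| ≤ C φ v t` for small `v > 0`. -/
def DominatedBy (φ f : ℝ → ℝ → ℝ) : Prop :=
  ∃ C : ℝ, 0 < C ∧ ∀ᶠ v in nhdsWithin (0 : ℝ) (Set.Ioi 0), ∀ t, |f v t| ≤ C * φ v t

lemma eventually_small_pos {ε : ℝ} (hε : 0 < ε) :
    ∀ᶠ v in nhdsWithin (0 : ℝ) (Set.Ioi 0), 0 < v ∧ v < ε :=
  Ioo_mem_nhdsGT hε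

namespace SymbolBound

variable {n : ℕ} {φ ψ f g : ℝ → ℝ → ℝ}

lemma mono (h : SymbolBound n φ f) {K : ℝ} (hK : 0 < K)
    (hφ : ∀ᶠ v in nhdsWithin (0 : ℝ) (Set.Ioi 0), ∀ t, φ v t ≤ K * ψ v t) :
    SymbolBound n ψ f := by
  obtain ⟨C, hC, h⟩ := h
  refine ⟨C * K, by positivity, ?_⟩
  filter_upwards [h, hφ, eventually_small_pos one_pos] with v hv hv' ⟨hv0, _⟩
  refine ⟨hv.1, fun l hl t => (hv.2 l hl t).trans ?_⟩
  calc C * v ^ l * φ v t ≤ C * v ^ l * (K * ψ v t) := by gcongr; exact hv' t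
    _ = _ := by ring

lemma congr (h : SymbolBound n φ f)
    (hfg : ∀ᶠ v in nhdsWithin (0 : ℝ) (Set.Ioi 0), g v = f v) : SymbolBound n φ g := by
  obtain ⟨C, hC, h⟩ := h
  refine ⟨C, hC, ?_⟩
  filter_upwards [h, hfg] with v hv hv'
  rwa [hv']

lemma contDiff (h : SymbolBound n φ f) :
    ∀ᶠ v in nhdsWithin (0 : ℝ) (Set.Ioi 0), ContDiff ℝ (⊤ : ℕ∞) (f v) := by
  obtain ⟨C, -, h⟩ := h
  exact h.mono fun v hv => hv.1

lemma dominatedBy (h : SymbolBound n φ f) : DominatedBy φ f := by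
  obtain ⟨C, hC, h⟩ := h
  refine ⟨C, hC, h.mono fun v hv t => ?_⟩
  simpa using hv.2 0 (Nat.zero_le _) t

lemma const (c : ℝ → ℝ) : SymbolBound n (fun v _ => |c v|) (fun v _ => c v) := by
  refine ⟨1, one_pos, ?_⟩
  filter_upwards [eventually_small_pos one_pos] with v ⟨hv0, _⟩
  refine ⟨contDiff_const, fun l _ t => ?_⟩
  rw [iteratedDeriv_const]
  split_ifs with h
  · simp [h]
  · rw [abs_zero]; positivity

lemma add (hf : SymbolBound n φ f) (hg : SymbolBound n φ g) :
    SymbolBound n φ (fun v t => f v t + g v t) := by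
  obtain ⟨C, hC, hf⟩ := hf
  obtain ⟨D, hD, hg⟩ := hg
  refine ⟨C + D, by positivity, ?_⟩
  filter_upwards [hf, hg] with v hv hv'
  refine ⟨hv.1.add hv'.1, fun l hl t => ?_⟩
  rw [iteratedDeriv_fun_add (hv.1.of_le (mod_cast le_top)).contDiffAt
    (hv'.1.of_le (mod_cast le_top)).contDiffAt]
  calc _ ≤ |iteratedDeriv l (f v) t| + |iteratedDeriv l (g v) t| := abs_add_le _ _
    _ ≤ C * v ^ l * φ v t + D * v ^ l * φ v t := add_le_add (hv.2 l hl t) (hv'.2 l hl t)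
    _ = _ := by ring

lemma mul (hf : SymbolBound n φ f) (hg : SymbolBound n ψ g) :
    SymbolBound n (fun v t => φ v t * ψ v t) (fun v t => f v t * g v t) := by
  obtain ⟨C, hC, hf⟩ := hf
  obtain ⟨D, hD, hg⟩ := hg
  refine ⟨2 ^ n * (C * D), by positivity, ?_⟩
  filter_upwards [hf, hg, eventually_small_pos one_pos] with v hv hv' ⟨hv0, _⟩
  refine ⟨hv.1.mul hv'.1, fun l hl t => ?_⟩
  have hφ : 0 ≤ φ v t := by
    have := (abs_nonneg _).trans (hv.2 0 (Nat.zero_le _) t)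
    simp only [pow_zero, mul_one] at this
    exact (mul_nonneg_iff_of_pos_left hC).1 this
  have hψ : 0 ≤ ψ v t := by
    have := (abs_nonneg _).trans (hv'.2 0 (Nat.zero_le _) t)
    simp only [pow_zero, mul_one] at this
    exact (mul_nonneg_iff_of_pos_left hD).1 this
  rw [iteratedDeriv_fun_mul (hv.1.of_le (mod_cast le_top)).contDiffAt
    (hv'.1.of_le (mod_cast le_top)).contDiffAt]
  calc _ ≤ ∑ i ∈ Finset.range (l + 1),
        |(l.choose i : ℝ) * iteratedDeriv i (f v) t * iteratedDeriv (l - i) (g v) t| :=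
        Finset.abs_sum_le_sum_abs _ _
    _ ≤ ∑ i ∈ Finset.range (l + 1), (l.choose i : ℝ) * (C * D * v ^ l * (φ v t * ψ v t)) := by
        refine Finset.sum_le_sum fun i hi => ?_
        have hil : i ≤ l := Nat.lt_succ_iff.1 (Finset.mem_range.1 hi)
        rw [abs_mul, abs_mul, Nat.abs_cast, mul_assoc]
        refine mul_le_mul_of_nonneg_left ?_ (Nat.cast_nonneg _)
        calc _ ≤ (C * v ^ i * φ v t) * (D * v ^ (l - i) * ψ v t) :=
              mul_le_mul (hv.2 i (hil.trans hl) t) (hv'.2 _ ((Nat.sub_le _ _).trans hl) t)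
                (abs_nonneg _) (by positivity)
          _ = C * D * (v ^ i * v ^ (l - i)) * (φ v t * ψ v t) := by ring
          _ = _ := by rw [← pow_add, Nat.add_sub_cancel' hil]
    _ = 2 ^ l * (C * D) * v ^ l * (φ v t * ψ v t) := by
        rw [← Finset.sum_mul, ← Nat.cast_sum, Nat.sum_range_choose]
        push_cast; ring
    _ ≤ _ := by
        gcongr
        norm_num

lemma const_mul (c : ℝ) (hf : SymbolBound n φ f) : SymbolBound n φ (fun v t => c * f v t) := by
  obtain ⟨C, hC, hf⟩ := hf
  refine ⟨(|c| + 1) * C, by positivity, ?_⟩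
  filter_upwards [hf] with v hv
  refine ⟨contDiff_const.mul hv.1, fun l hl t => ?_⟩
  rw [iteratedDeriv_const_mul c (hv.1.of_le (mod_cast le_top)).contDiffAt, abs_mul]
  calc _ ≤ (|c| + 1) * |iteratedDeriv l (f v) t| := by gcongr; linarith
    _ ≤ (|c| + 1) * (C * v ^ l * φ v t) := by gcongr; exact hv.2 l hl t
    _ = _ := by ring

lemma deriv (h : SymbolBound (n + 1) φ f) :
    SymbolBound n (fun v t => v * φ v t) (fun v => deriv (f v)) := by
  obtain ⟨C, hC, h⟩ := h
  refine ⟨C, hC, h.mono fun v hv => ⟨(contDiff_infty_iff_deriv.1 hv.1).2, fun l hl t => ?_⟩⟩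
  rw [← iteratedDeriv_succ']
  refine (hv.2 (l + 1) (by lia) t).trans (le_of_eq ?_)
  ring

lemma of_dominatedBy
    (hs : ∀ᶠ v in nhdsWithin (0 : ℝ) (Set.Ioi 0), ContDiff ℝ (⊤ : ℕ∞) (f v))
    (hf : DominatedBy φ f) : SymbolBound 0 φ f := by
  obtain ⟨C, hC, hf⟩ := hf
  refine ⟨C, hC, ?_⟩
  filter_upwards [hs, hf] with v hv hv'
  refine ⟨hv, fun l hl t => ?_⟩
  obtain rfl : l = 0 := by lia
  simpa using hv' t

lemma of_deriv
    (hs : ∀ᶠ v in nhdsWithin (0 : ℝ) (Set.Ioi 0), ContDiff ℝ (⊤ : ℕ∞) (f v))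
    (hf : DominatedBy φ f)
    (hd : SymbolBound n (fun v t => v * φ v t) (fun v => _root_.deriv (f v))) :
    SymbolBound (n + 1) φ f := by
  obtain ⟨C, hC, hf⟩ := hf
  obtain ⟨D, hD, hd⟩ := hd
  refine ⟨C + D, by positivity, ?_⟩
  filter_upwards [hs, hf, hd, eventually_small_pos one_pos] with v h1 h2 h3 ⟨hv0, _⟩
  refine ⟨h1, fun l hl t => ?_⟩
  have hφ : 0 ≤ φ v t := (mul_nonneg_iff_of_pos_left hC).1 ((abs_nonneg _).trans (h2 t))
  rcases l with _ | l
  · rw [iteratedDeriv_zero]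
    refine (h2 t).trans ?_
    rw [pow_zero, mul_one]
    gcongr
    linarith
  · rw [iteratedDeriv_succ']
    refine (h3.2 l (by lia) t).trans ?_
    rw [show D * v ^ l * (v * φ v t) = D * v ^ (l + 1) * φ v t by ring]
    gcongr
    linarith

/-- Bootstrapping: a differential equation controlling `f'` by `f` propagates bounds. -/
lemma of_bootstrap
    (hs : ∀ᶠ v in nhdsWithin (0 : ℝ) (Set.Ioi 0), ContDiff ℝ (⊤ : ℕ∞) (f v))
    (hf : DominatedBy φ f)
    (hd : ∀ n, SymbolBound n φ f →
      SymbolBound n (fun v t => v * φ v t) (fun v => _root_.deriv (f v))) (n : ℕ) :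
    SymbolBound n φ f := by
  induction n with
  | zero => exact of_dominatedBy hs hf
  | succ n ih => exact of_deriv hs hf (hd n ih)

lemma of_linear_ode {a : ℝ → ℝ → ℝ} (ha : ∀ n, SymbolBound n (fun v _ => v) a)
    (hs : ∀ᶠ v in nhdsWithin (0 : ℝ) (Set.Ioi 0), ContDiff ℝ (⊤ : ℕ∞) (f v))
    (hf : DominatedBy φ f)
    (hd : ∀ᶠ v in nhdsWithin (0 : ℝ) (Set.Ioi 0), _root_.deriv (f v) = fun t => a v t * f v t)
    (n : ℕ) : SymbolBound n φ f :=
  of_bootstrap hs hf (fun n h => ((ha n).mul h).congr hd) n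

lemma exists_bound (h : SymbolBound n φ f) : ∃ C v₀ : ℝ, 0 < C ∧ 0 < v₀ ∧
    ∀ v : ℝ, 0 < v → v < v₀ → ∀ t, |iteratedDeriv n (f v) t| ≤ C * v ^ n * φ v t := by
  obtain ⟨C, hC, h⟩ := h
  obtain ⟨v₀, hv₀, h⟩ := mem_nhdsGT_iff_exists_Ioo_subset.1 h
  exact ⟨C, v₀, hC, hv₀, fun v h0 h1 t => (h ⟨h0, h1⟩).2 n le_rfl t⟩

lemma of_forall_exists (hφ : ∀ᶠ v in nhdsWithin (0 : ℝ) (Set.Ioi 0), ∀ t, 0 ≤ φ v t)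
    (hs : ∀ᶠ v in nhdsWithin (0 : ℝ) (Set.Ioi 0), ContDiff ℝ (⊤ : ℕ∞) (f v))
    (h : ∀ l : ℕ, ∃ C v₀ : ℝ, 0 < C ∧ 0 < v₀ ∧ ∀ v : ℝ, 0 < v → v < v₀ → ∀ t : ℝ,
      |iteratedDeriv l (f v) t| ≤ C * v ^ l * φ v t) (n : ℕ) : SymbolBound n φ f := by
  choose C v₀ hC hv₀ h using h
  refine ⟨∑ i ∈ Finset.range (n + 1), C i,
    Finset.sum_pos (fun i _ => hC i) ⟨0, by simp⟩, ?_⟩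
  have h' : ∀ᶠ v in nhdsWithin (0 : ℝ) (Set.Ioi 0), ∀ i ∈ Finset.range (n + 1),
      0 < v ∧ v < v₀ i := by
    rw [Finset.eventually_all]
    exact fun i _ => eventually_small_pos (hv₀ i)
  filter_upwards [hφ, hs, h', eventually_small_pos one_pos] with v h1 h2 h3 ⟨hv0, _⟩
  refine ⟨h2, fun l hl t => ?_⟩
  have hmem : l ∈ Finset.range (n + 1) := by simpa [Nat.lt_succ_iff] using hl
  refine (h l v hv0 (h3 l hmem).2 t).trans ?_
  have := h1 t
  gcongr
  exact Finset.single_le_sum (fun i _ => (hC i).le) hmem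

end SymbolBound

lemma hasDerivAt_tanh (x : ℝ) : HasDerivAt Real.tanh (1 - Real.tanh x ^ 2) x := by
  have h := (Real.hasDerivAt_sinh x).div (Real.hasDerivAt_cosh x) (Real.cosh_pos x).ne'
  have h1 : Real.tanh = Real.sinh / Real.cosh := by
    ext y
    simp [Real.tanh_eq_sinh_div_cosh]
  rw [← h1] at h
  refine h.congr_deriv ?_
  have := (Real.cosh_pos x).ne'
  rw [Real.tanh_eq_sinh_div_cosh]
  field_simp

lemma contDiff_tanh : ContDiff ℝ (⊤ : ℕ∞) Real.tanh := by
  have h1 : Real.tanh = fun x => Real.sinh x / Real.cosh x := by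
    ext y
    simp [Real.tanh_eq_sinh_div_cosh]
  rw [h1]
  exact Real.contDiff_sinh.div Real.contDiff_cosh fun x => (Real.cosh_pos x).ne'

lemma one_sub_tanh_sq (x : ℝ) : 1 - Real.tanh x ^ 2 = (Real.cosh x ^ 2)⁻¹ := by
  have := (Real.cosh_pos x).ne'
  rw [Real.tanh_eq_sinh_div_cosh]
  field_simp
  linarith [Real.cosh_sq x]

lemma tanh_sq_le_one (x : ℝ) : Real.tanh x ^ 2 ≤ 1 := by
  have := one_sub_tanh_sq x
  have h : 0 ≤ (Real.cosh x ^ 2)⁻¹ := by positivity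
  linarith

lemma exp_abs_div_two_le_cosh (x : ℝ) : Real.exp |x| / 2 ≤ Real.cosh x := by
  rw [← Real.cosh_abs, Real.cosh_eq]
  linarith [Real.exp_pos (-|x|)]

lemma cosh_le_exp_abs (x : ℝ) : Real.cosh x ≤ Real.exp |x| := by
  rw [← Real.cosh_abs, Real.cosh_eq]
  have : Real.exp (-|x|) ≤ Real.exp |x| := Real.exp_le_exp.2 (by linarith [abs_nonneg x])
  linarith

lemma inv_cosh_sq_le (x : ℝ) : (Real.cosh x ^ 2)⁻¹ ≤ 4 * Real.exp (-(2 * |x|)) := by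
  have h : (Real.exp |x| / 2) ^ 2 ≤ Real.cosh x ^ 2 := by
    gcongr
    exact exp_abs_div_two_le_cosh x
  have h' : (4 * Real.exp (-(2 * |x|))) = ((Real.exp |x| / 2) ^ 2)⁻¹ := by
    rw [Real.exp_neg, two_mul, Real.exp_add]
    field_simp
    norm_num
  rw [h']
  exact inv_anti₀ (by positivity) h

/-- The rescaled hyperbolic tangent `tanh(√2 v t)`. -/
def tanhFam (v t : ℝ) : ℝ := Real.tanh (Real.sqrt 2 * v * t)

/-- The decay weight `e^{-2√2|t|v}`. -/
def decayWeight (v t : ℝ) : ℝ := Real.exp (-(2 * Real.sqrt 2 * |t| * v))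

/-- The weight `|t| v + ln(1/v)`. -/
def logWeight (v t : ℝ) : ℝ := |t| * v + Real.log (1 / v)

lemma tanhFam_sq_le_one (v t : ℝ) : tanhFam v t ^ 2 ≤ 1 := tanh_sq_le_one _

lemma abs_tanhFam_le_one (v t : ℝ) : |tanhFam v t| ≤ 1 :=
  (sq_le_one_iff_abs_le_one _).1 (tanhFam_sq_le_one v t)

lemma hasDerivAt_tanhFam (v t : ℝ) :
    HasDerivAt (tanhFam v) (Real.sqrt 2 * v * (1 - tanhFam v t ^ 2)) t := by
  have h : HasDerivAt (fun t => Real.sqrt 2 * v * t) (Real.sqrt 2 * v) t := by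
    simpa using (hasDerivAt_id t).const_mul (Real.sqrt 2 * v)
  refine ((hasDerivAt_tanh (Real.sqrt 2 * v * t)).comp t h).congr_deriv ?_
  rw [tanhFam]
  ring

lemma contDiff_tanhFam (v : ℝ) : ContDiff ℝ (⊤ : ℕ∞) (tanhFam v) :=
  contDiff_tanh.comp (contDiff_const.mul contDiff_id)

lemma decayWeight_pos (v t : ℝ) : 0 < decayWeight v t := Real.exp_pos _

lemma decayWeight_le_one {v : ℝ} (hv : 0 < v) (t : ℝ) : decayWeight v t ≤ 1 := by
  refine Real.exp_le_one_iff.2 ?_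
  have : 0 ≤ 2 * Real.sqrt 2 * |t| * v := by positivity
  linarith

lemma abs_sqrt_two_mul {v : ℝ} (hv : 0 < v) (t : ℝ) :
    |Real.sqrt 2 * v * t| = Real.sqrt 2 * v * |t| := by
  rw [abs_mul, abs_of_pos (by positivity)]

lemma inv_cosh_sq_le_decayWeight {v : ℝ} (hv : 0 < v) (t : ℝ) :
    (Real.cosh (Real.sqrt 2 * v * t) ^ 2)⁻¹ ≤ 4 * decayWeight v t := by
  refine (inv_cosh_sq_le _).trans (le_of_eq ?_)
  rw [abs_sqrt_two_mul hv, decayWeight]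
  ring_nf

lemma one_le_logWeight {v : ℝ} (hv : 0 < v) (hv' : v < Real.exp (-1)) (t : ℝ) :
    1 ≤ Real.log (1 / v) ∧ Real.log (1 / v) ≤ logWeight v t := by
  constructor
  · rw [one_div, Real.log_inv]
    have := Real.log_lt_log hv hv'
    rw [Real.log_exp] at this
    linarith
  · have : 0 ≤ |t| * v := by positivity
    simp only [logWeight]
    linarith

lemma sq_mul_logWeight_mul_decayWeight_le {v : ℝ} (hv : 0 < v) (hv' : v < 1) (t : ℝ) :
    v ^ 2 * logWeight v t * decayWeight v t ≤ 2 := by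
  have h0 := (decayWeight_pos v t).le
  have h1 : v * Real.log (1 / v) ≤ 1 := by
    have := Real.log_le_sub_one_of_pos (show 0 < 1 / v by positivity)
    calc v * Real.log (1 / v) ≤ v * (1 / v - 1) := by gcongr
      _ = 1 - v := by field_simp
      _ ≤ 1 := by linarith
  have h2 : |t| * v * decayWeight v t ≤ 1 := by
    have h3 : decayWeight v t ≤ Real.exp (-(|t| * v)) := by
      refine Real.exp_le_exp.2 ?_
      have h4 : 1 ≤ Real.sqrt 2 := Real.one_le_sqrt.2 (by norm_num)
      have h5 : 0 ≤ |t| * v := by positivity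
      nlinarith
    calc |t| * v * decayWeight v t ≤ Real.exp (|t| * v) * Real.exp (-(|t| * v)) := by
          gcongr
          linarith [Real.add_one_le_exp (|t| * v)]
      _ = 1 := by rw [← Real.exp_add]; simp
  have h3 := decayWeight_le_one hv t
  have h5 : 0 ≤ Real.log (1 / v) := Real.log_nonneg (by rw [le_div_iff₀ hv]; linarith)
  have h6 : v ^ 2 ≤ 1 := by nlinarith
  calc v ^ 2 * logWeight v t * decayWeight v t
      = v ^ 2 * (|t| * v * decayWeight v t)
        + v * (v * Real.log (1 / v)) * decayWeight v t := by simp only [logWeight]; ring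
    _ ≤ 1 * 1 + 1 * 1 * 1 := by gcongr
    _ = 2 := by norm_num

lemma eventually_pow_mul_log_pow_le_one {n₁ : ℕ} (hn₁ : 1 ≤ n₁) (n₂ : ℕ) :
    ∀ᶠ v in nhdsWithin (0 : ℝ) (Set.Ioi 0), v ^ n₁ * Real.log (1 / v) ^ n₂ ≤ 1 := by
  have h := (Real.isLittleO_pow_log_id_atTop (n := n₂)).bound one_pos
  have h' := tendsto_inv_nhdsGT_zero.eventually h
  filter_upwards [h', eventually_small_pos one_pos] with v hv ⟨hv0, hv1⟩
  rw [← one_div] at hv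
  simp only [id, one_mul, Real.norm_eq_abs] at hv
  rw [abs_of_pos (show 0 < 1 / v by positivity)] at hv
  have h5 : 0 ≤ Real.log (1 / v) := Real.log_nonneg (by rw [le_div_iff₀ hv0]; linarith)
  calc v ^ n₁ * Real.log (1 / v) ^ n₂ ≤ v ^ 1 * (1 / v) := by
        refine mul_le_mul (pow_le_pow_of_le_one hv0.le hv1.le hn₁) ((le_abs_self _).trans hv)
          (by positivity) (by positivity)
    _ = 1 := by field_simp

namespace SymbolBound

lemma tanhFam (n : ℕ) : SymbolBound n (fun _ _ => 1) tanhFam := by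
  refine of_bootstrap (.of_forall contDiff_tanhFam)
    ⟨1, one_pos, .of_forall fun v t => by simpa using abs_tanhFam_le_one v t⟩ (fun n h => ?_) n
  have h1 := (const (n := n) (fun _ => 1)).add (by simpa using (h.mul h).const_mul (-1))
  have h2 := (const (n := n) (fun v => Real.sqrt 2 * v)).mul h1
  refine (h2.congr (.of_forall fun v => ?_)).mono (Real.sqrt_pos.2 two_pos) ?_
  · ext t
    rw [(hasDerivAt_tanhFam v t).deriv]
    ring
  · filter_upwards [eventually_small_pos one_pos] with v ⟨hv0, _⟩ t
    rw [abs_of_pos (by positivity)]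
    simp

lemma one_sub_tanhFam_sq (n : ℕ) :
    SymbolBound n decayWeight (fun v t => 1 - _root_.tanhFam v t ^ 2) := by
  refine of_linear_ode (a := fun v t => -2 * (Real.sqrt 2 * v) * _root_.tanhFam v t)
    (fun n => ?_) (.of_forall fun v => contDiff_const.sub ((contDiff_tanhFam v).pow 2))
    ⟨4, by norm_num, ?_⟩ (.of_forall fun v => ?_) n
  · refine ((const fun v => -2 * (Real.sqrt 2 * v)).mul (tanhFam n)).mono
      (K := 2 * Real.sqrt 2) (by positivity) ?_
    filter_upwards [eventually_small_pos one_pos] with v ⟨hv0, _⟩ t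
    rw [abs_mul, abs_of_pos (show 0 < Real.sqrt 2 * v by positivity)]
    norm_num
    linarith
  · filter_upwards [eventually_small_pos one_pos] with v ⟨hv0, _⟩ t
    have h := inv_cosh_sq_le_decayWeight hv0 t
    rw [_root_.tanhFam, one_sub_tanh_sq, abs_of_nonneg (by positivity)]
    exact h
  · ext t
    rw [(((hasDerivAt_tanhFam v t).fun_pow 2).const_sub 1).deriv]
    push_cast
    ring

end SymbolBound

/-- Powers of the Lorentz factor: `(1 - v² tanh²(√2 v t))^α`. -/
def lorentzPow (α v t : ℝ) : ℝ := (1 - v ^ 2 * tanhFam v t ^ 2) ^ α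

lemma lorentz_mem {v : ℝ} (hv : 0 < v) (hv' : v < 1 / 2) (t : ℝ) :
    3 / 4 ≤ 1 - v ^ 2 * tanhFam v t ^ 2 ∧ 1 - v ^ 2 * tanhFam v t ^ 2 ≤ 1 := by
  have h1 := tanhFam_sq_le_one v t
  have h2 : 0 ≤ v ^ 2 * tanhFam v t ^ 2 := by positivity
  have h3 : v ^ 2 * tanhFam v t ^ 2 ≤ (1 / 2) ^ 2 * 1 := by gcongr
  constructor <;> linarith

lemma contDiff_lorentzPow (α : ℝ) {v : ℝ} (hv : 0 < v) (hv' : v < 1 / 2) :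
    ContDiff ℝ (⊤ : ℕ∞) (lorentzPow α v) :=
  (contDiff_const.sub (contDiff_const.mul ((contDiff_tanhFam v).pow 2))).rpow_const_of_ne
    fun t => by linarith [(lorentz_mem hv hv' t).1]

/-- The factor `a` in `∂ₜ (1 - v² tanh²)^α = a (1 - v² tanh²)^α (1 - v² tanh²)⁻¹`. -/
def lorentzCoeff (α v t : ℝ) : ℝ :=
  -(2 * α * Real.sqrt 2) * (v * v ^ 2 * (tanhFam v t * (1 - tanhFam v t ^ 2)))

lemma deriv_lorentzPow (α : ℝ) {v : ℝ} (hv : 0 < v) (hv' : v < 1 / 2) :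
    deriv (lorentzPow α v) =
      fun t => lorentzCoeff α v t * lorentzPow (-1) v t * lorentzPow α v t := by
  ext t
  have hg : 0 < 1 - v ^ 2 * tanhFam v t ^ 2 := by linarith [(lorentz_mem hv hv' t).1]
  have h := ((((hasDerivAt_tanhFam v t).fun_pow 2).const_mul (v ^ 2)).const_sub 1).rpow_const
    (p := α) (Or.inl hg.ne')
  rw [show lorentzPow α v = fun t => (1 - v ^ 2 * tanhFam v t ^ 2) ^ α from rfl, h.deriv]
  simp only [lorentzCoeff, lorentzPow]
  rw [Real.rpow_sub_one hg.ne', Real.rpow_neg_one]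
  push_cast
  field_simp

lemma abs_lorentzPow_sub_one_le (α : ℝ) :
    ∀ᶠ v in nhdsWithin (0 : ℝ) (Set.Ioi 0), ∀ t,
      |lorentzPow α v t - 1| ≤ (4 * (|α| + 1)) * v ^ 2 := by
  have hα : 0 ≤ |α| := abs_nonneg α
  filter_upwards [eventually_small_pos (show (0 : ℝ) < 1 / (2 * (|α| + 1)) by positivity)]
    with v ⟨hv0, hv1⟩ t
  have hv2 : v < 1 / 2 := hv1.trans_le (by gcongr; linarith)
  rw [lt_div_iff₀ (by positivity)] at hv1
  obtain ⟨hg1, hg2⟩ := lorentz_mem hv0 hv2 t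
  set g := 1 - v ^ 2 * tanhFam v t ^ 2 with hg
  have hu : 1 - g ≤ v ^ 2 := by
    have := tanhFam_sq_le_one v t
    rw [hg]
    nlinarith [sq_nonneg v]
  have hg0 : 0 < g := by linarith
  have hlog : |Real.log g| ≤ 2 * v ^ 2 := by
    rw [abs_of_nonpos (Real.log_nonpos hg0.le hg2)]
    have h1 := Real.one_sub_inv_le_log_of_pos hg0
    have h2 : g⁻¹ - 1 ≤ 2 * (1 - g) := by
      rw [inv_eq_one_div, div_sub_one hg0.ne', div_le_iff₀ hg0]
      nlinarith
    linarith
  have hexp : |Real.log g * α| ≤ 2 * (|α| + 1) * v ^ 2 := by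
    rw [abs_mul]
    nlinarith [abs_nonneg (Real.log g), sq_nonneg v]
  have hle : |Real.log g * α| ≤ 1 := hexp.trans (by nlinarith)
  rw [lorentzPow, ← hg, Real.rpow_def_of_pos hg0]
  refine (Real.abs_exp_sub_one_le hle).trans ?_
  linarith

namespace SymbolBound

lemma lorentzCoeff (α : ℝ) (n : ℕ) :
    SymbolBound n (fun v t => v * (v ^ 2 * decayWeight v t)) (lorentzCoeff α) := by
  refine (((const fun v => v * v ^ 2).mul
    ((tanhFam n).mul (one_sub_tanhFam_sq n))).const_mul (-(2 * α * Real.sqrt 2))).mono one_pos ?_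
  filter_upwards [eventually_small_pos one_pos] with v ⟨hv0, _⟩ t
  rw [abs_of_pos (by positivity)]
  apply le_of_eq
  ring

lemma lorentzCoeff' (α : ℝ) (n : ℕ) : SymbolBound n (fun v _ => v) (_root_.lorentzCoeff α) := by
  refine (lorentzCoeff α n).mono one_pos ?_
  filter_upwards [eventually_small_pos one_pos] with v ⟨hv0, hv1⟩ t
  have h1 := decayWeight_le_one hv0 t
  have h2 := decayWeight_pos v t
  have h6 : v ^ 2 ≤ 1 := by nlinarith
  calc v * (v ^ 2 * decayWeight v t) ≤ v * (1 * 1) := by gcongr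
    _ = 1 * v := by ring

lemma dominatedBy_lorentzPow (α : ℝ) : DominatedBy (fun _ _ => 1) (lorentzPow α) := by
  refine ⟨4 * (|α| + 1) + 1, by positivity, ?_⟩
  filter_upwards [abs_lorentzPow_sub_one_le α, eventually_small_pos one_pos] with v hv ⟨h0, h1⟩ t
  have h6 : v ^ 2 ≤ 1 := by nlinarith
  have := abs_add_le (_root_.lorentzPow α v t - 1) 1
  rw [sub_add_cancel, abs_one] at this
  nlinarith [hv t, abs_nonneg α]

lemma lorentzPow_neg_one (n : ℕ) : SymbolBound n (fun _ _ => 1) (lorentzPow (-1)) := by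
  refine of_bootstrap ?_ (dominatedBy_lorentzPow _) (fun n h => ?_) n
  · filter_upwards [eventually_small_pos (show (0 : ℝ) < 1 / 2 by norm_num)] with v ⟨h0, h1⟩
    exact contDiff_lorentzPow _ h0 h1
  · refine ((((lorentzCoeff' (-1) n).mul h).mul h).mono one_pos ?_).congr ?_
    · exact .of_forall fun v t => by simp
    · filter_upwards [eventually_small_pos (show (0 : ℝ) < 1 / 2 by norm_num)] with v ⟨h0, h1⟩
      exact deriv_lorentzPow _ h0 h1

lemma lorentzPow (α : ℝ) (n : ℕ) : SymbolBound n (fun _ _ => 1) (lorentzPow α) := by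
  refine of_linear_ode (a := fun v t => _root_.lorentzCoeff α v t * _root_.lorentzPow (-1) v t)
    (fun n => ?_) ?_ (dominatedBy_lorentzPow _) ?_ n
  · refine ((lorentzCoeff' α n).mul (lorentzPow_neg_one n)).mono one_pos ?_
    exact .of_forall fun v t => by simp
  · filter_upwards [eventually_small_pos (show (0 : ℝ) < 1 / 2 by norm_num)] with v ⟨h0, h1⟩
    exact contDiff_lorentzPow _ h0 h1
  · filter_upwards [eventually_small_pos (show (0 : ℝ) < 1 / 2 by norm_num)] with v ⟨h0, h1⟩
    exact deriv_lorentzPow _ h0 h1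

lemma deriv_lorentzPow (α : ℝ) (n : ℕ) :
    SymbolBound n (fun v t => v * (v ^ 2 * decayWeight v t))
      (fun v => _root_.deriv (_root_.lorentzPow α v)) := by
  refine ((((lorentzCoeff α n).mul (lorentzPow_neg_one n)).mul (lorentzPow α n)).mono
    one_pos (.of_forall fun v t => by simp)).congr ?_
  filter_upwards [eventually_small_pos (show (0 : ℝ) < 1 / 2 by norm_num)] with v ⟨h0, h1⟩
  exact _root_.deriv_lorentzPow _ h0 h1

lemma lorentzPow_sub_one (α : ℝ) (n : ℕ) :
    SymbolBound n (fun v _ => v ^ 2) (fun v t => _root_.lorentzPow α v t - 1) := by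
  have hs : ∀ᶠ v in nhdsWithin (0 : ℝ) (Set.Ioi 0),
      ContDiff ℝ (⊤ : ℕ∞) (fun t => _root_.lorentzPow α v t - 1) :=
    (lorentzPow α 0).contDiff.mono fun v hv => hv.sub contDiff_const
  refine of_bootstrap hs ⟨4 * (|α| + 1), by positivity, abs_lorentzPow_sub_one_le α⟩
    (fun n _ => ?_) n
  refine ((deriv_lorentzPow α n).congr (.of_forall fun v => by ext t; simp)).mono one_pos ?_
  filter_upwards [eventually_small_pos one_pos] with v ⟨hv0, hv1⟩ t
  have h1 := decayWeight_le_one hv0 t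
  calc v * (v ^ 2 * decayWeight v t) ≤ v * (v ^ 2 * 1) := by gcongr
    _ = 1 * (v * v ^ 2) := by ring

end SymbolBound

lemma hasDerivAt_dv {v : ℝ} (hv : 0 < v) (t : ℝ) :
    HasDerivAt (dv v) (2 * v * tanhFam v t) t := by
  have h : HasDerivAt (fun t => Real.sqrt 2 * v * t) (Real.sqrt 2 * v) t := by
    simpa using (hasDerivAt_id t).const_mul (Real.sqrt 2 * v)
  have hc := Real.cosh_pos (Real.sqrt 2 * v * t)
  have h1 := ((((h.cosh).fun_pow 2).const_mul (8 / v ^ 2)).log (by positivity)).const_mul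
    (1 / Real.sqrt 2)
  refine h1.congr_deriv ?_
  rw [tanhFam, Real.tanh_eq_sinh_div_cosh]
  push_cast
  field_simp

lemma contDiff_dv {v : ℝ} (hv : 0 < v) : ContDiff ℝ (⊤ : ℕ∞) (dv v) := by
  refine contDiff_const.mul (ContDiff.log (contDiff_const.mul
    ((Real.contDiff_cosh.comp (contDiff_const.mul contDiff_id)).pow 2)) fun t => ?_)
  have hc := Real.cosh_pos (Real.sqrt 2 * v * t)
  positivity

lemma dv_nonneg {v : ℝ} (hv : 0 < v) (hv' : v < 1) (t : ℝ) : 0 ≤ dv v t := by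
  refine mul_nonneg (by positivity) (Real.log_nonneg ?_)
  have h1 : 1 ≤ 8 / v ^ 2 := by
    rw [le_div_iff₀ (by positivity)]
    nlinarith
  have h2 := one_le_pow₀ (n := 2) (Real.one_le_cosh (Real.sqrt 2 * v * t))
  nlinarith

lemma dv_le {v : ℝ} (hv : 0 < v) (hv' : v < Real.exp (-1)) (t : ℝ) :
    dv v t ≤ 9 * logWeight v t := by
  obtain ⟨h1, -⟩ := one_le_logWeight hv hv' t
  have hc := Real.cosh_pos (Real.sqrt 2 * v * t)
  have h2 : Real.log (8 / v ^ 2 * Real.cosh (Real.sqrt 2 * v * t) ^ 2)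
      = Real.log 8 + 2 * Real.log (1 / v) + 2 * Real.log (Real.cosh (Real.sqrt 2 * v * t)) := by
    rw [Real.log_mul (by positivity) (by positivity), Real.log_div (by norm_num) (by positivity),
      Real.log_pow, Real.log_pow, one_div, Real.log_inv]
    push_cast
    ring
  have h3 : Real.log 8 ≤ 7 := by
    have := Real.log_le_sub_one_of_pos (show (0 : ℝ) < 8 by norm_num)
    linarith
  have h4 : Real.log (Real.cosh (Real.sqrt 2 * v * t)) ≤ Real.sqrt 2 * v * |t| := by
    rw [← abs_sqrt_two_mul hv, ← Real.log_exp |Real.sqrt 2 * v * t|]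
    exact Real.log_le_log hc (cosh_le_exp_abs _)
  have h5 : Real.sqrt 2 ≤ 2 := Real.sqrt_le_iff.2 ⟨by norm_num, by norm_num⟩
  have h6 : 1 / Real.sqrt 2 ≤ 1 := by
    rw [div_le_one (by positivity)]
    exact Real.one_le_sqrt.2 (by norm_num)
  have h7 : 0 ≤ |t| * v := by positivity
  have h8 : Real.log (8 / v ^ 2 * Real.cosh (Real.sqrt 2 * v * t) ^ 2) ≤ 9 * logWeight v t := by
    rw [h2]
    simp only [logWeight]
    nlinarith
  have h9 : 0 ≤ 9 * logWeight v t := by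
    simp only [logWeight]
    linarith
  rw [dv]
  calc _ ≤ 1 / Real.sqrt 2 * (9 * logWeight v t) := by gcongr
    _ ≤ 1 * (9 * logWeight v t) := by gcongr
    _ = _ := one_mul _

lemma exp_neg_sqrt_two_mul_dv_le {v : ℝ} (hv : 0 < v) (t : ℝ) :
    Real.exp (-(Real.sqrt 2 * dv v t)) ≤ v ^ 2 * decayWeight v t := by
  have hc := Real.cosh_pos (Real.sqrt 2 * v * t)
  have h1 : Real.sqrt 2 * dv v t
      = Real.log (8 / v ^ 2 * Real.cosh (Real.sqrt 2 * v * t) ^ 2) := by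
    rw [dv]
    field_simp
  rw [h1, Real.exp_neg, Real.exp_log (by positivity), mul_inv, inv_div]
  have h2 := inv_cosh_sq_le_decayWeight hv t
  have h3 := decayWeight_pos v t
  calc _ ≤ v ^ 2 / 8 * (4 * decayWeight v t) := by gcongr
    _ ≤ _ := by nlinarith [mul_pos (pow_pos hv 2) h3]

lemma abs_exp_sub_one_le_mul_exp {x M : ℝ} (hM : 0 ≤ M) (hx : x ≤ M) :
    |Real.exp x - 1| ≤ Real.exp M * |x| := by
  have hM1 : 1 ≤ Real.exp M := Real.one_le_exp hM
  rcases le_total 0 x with h | h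
  · rw [abs_of_nonneg (by linarith [Real.one_le_exp h]), abs_of_nonneg h]
    have h1 := Real.add_one_le_exp (-x)
    have h2 : Real.exp x * Real.exp (-x) = 1 := by rw [← Real.exp_add]; simp
    have h3 : Real.exp x - 1 ≤ Real.exp x * x := by nlinarith [Real.exp_pos x]
    exact h3.trans (by gcongr)
  · rw [abs_of_nonpos (by linarith [Real.exp_le_one_iff.2 h]), abs_of_nonpos h]
    nlinarith [Real.add_one_le_exp x]

/-- The excess `E` in `(d_v + r_v) (1 - ḋ_v²/4)^β = d_v + E`. -/
def excess (r : ℝ → ℝ → ℝ) (β v t : ℝ) : ℝ :=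
  dv v t * (lorentzPow β v t - 1) + r v t * lorentzPow β v t

lemma one_sub_deriv_dv_sq {v : ℝ} (hv : 0 < v) (t : ℝ) :
    1 - deriv (dv v) t ^ 2 / 4 = 1 - v ^ 2 * tanhFam v t ^ 2 := by
  rw [(hasDerivAt_dv hv t).deriv]
  ring

lemma pfun_eq (r : ℝ → ℝ → ℝ) (m₁ m₂ : ℕ) (m₃ : ℤ) {v : ℝ} (hv : 0 < v) (hv' : v < 1 / 2) :
    pfun r m₁ m₂ m₃ v = fun t => Real.exp (-((m₁ : ℝ) * Real.sqrt 2 * dv v t)) *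
      ((lorentzPow ((m₃ : ℝ) / 2) v t - 1)
          * Real.exp (-((m₁ : ℝ) * Real.sqrt 2) * excess r (-((m₂ : ℝ) / 2)) v t)
        + (Real.exp (-((m₁ : ℝ) * Real.sqrt 2) * excess r (-((m₂ : ℝ) / 2)) v t) - 1)) := by
  ext t
  have hg : 0 < 1 - v ^ 2 * tanhFam v t ^ 2 := by linarith [(lorentz_mem hv hv' t).1]
  rw [pfun, one_sub_deriv_dv_sq hv]
  have h1 : -((m₁ : ℝ) * Real.sqrt 2 * (dv v t + r v t)) /
        (1 - v ^ 2 * tanhFam v t ^ 2) ^ ((m₂ : ℝ) / 2)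
      = -((m₁ : ℝ) * Real.sqrt 2 * dv v t)
        + -((m₁ : ℝ) * Real.sqrt 2) * excess r (-((m₂ : ℝ) / 2)) v t := by
    rw [excess, lorentzPow, Real.rpow_neg hg.le, div_eq_mul_inv]
    ring
  rw [h1, Real.exp_add, lorentzPow]
  ring

namespace SymbolBound

variable {φ : ℝ → ℝ → ℝ}

lemma dv (n : ℕ) : SymbolBound n logWeight dv := by
  refine of_bootstrap ?_ ⟨9, by norm_num, ?_⟩ (fun n _ => ?_) n
  · filter_upwards [eventually_small_pos one_pos] with v ⟨hv0, _⟩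
    exact contDiff_dv hv0
  · filter_upwards [eventually_small_pos one_pos, eventually_small_pos (Real.exp_pos (-1))]
      with v ⟨hv0, hv1⟩ ⟨_, hv2⟩ t
    rw [abs_of_nonneg (dv_nonneg hv0 hv1 t)]
    exact dv_le hv0 hv2 t
  · refine (((const fun v => 2 * v).mul (tanhFam n)).congr ?_).mono two_pos ?_
    · filter_upwards [eventually_small_pos one_pos] with v ⟨hv0, _⟩
      ext t
      exact (hasDerivAt_dv hv0 t).deriv
    · filter_upwards [eventually_small_pos (Real.exp_pos (-1))] with v ⟨hv0, hv2⟩ t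
      obtain ⟨h1, h2⟩ := one_le_logWeight hv0 hv2 t
      rw [abs_of_pos (by positivity)]
      nlinarith

lemma deriv_dv (n : ℕ) : SymbolBound n (fun v _ => v) (fun v => _root_.deriv (_root_.dv v)) := by
  refine (((const fun v => 2 * v).mul (tanhFam n)).congr ?_).mono two_pos ?_
  · filter_upwards [eventually_small_pos one_pos] with v ⟨hv0, _⟩
    ext t
    exact (hasDerivAt_dv hv0 t).deriv
  · filter_upwards [eventually_small_pos one_pos] with v ⟨hv0, _⟩ t
    rw [abs_of_pos (by positivity), mul_one]

lemma exp_neg_dv {m : ℕ} (hm : 1 ≤ m) (n : ℕ) :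
    SymbolBound n (fun v t => v ^ (2 * m) * decayWeight v t)
      (fun v t => Real.exp (-((m : ℝ) * Real.sqrt 2 * _root_.dv v t))) := by
  refine of_linear_ode (fun n => (deriv_dv n).const_mul (-((m : ℝ) * Real.sqrt 2)))
    ?_ ⟨1, one_pos, ?_⟩ ?_ n
  · filter_upwards [eventually_small_pos one_pos] with v ⟨hv0, _⟩
    exact (contDiff_const.mul (contDiff_dv hv0)).neg.exp
  · filter_upwards [eventually_small_pos one_pos] with v ⟨hv0, _⟩ t
    have h1 : -((m : ℝ) * Real.sqrt 2 * _root_.dv v t)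
        = (m : ℝ) * -(Real.sqrt 2 * _root_.dv v t) := by ring
    rw [abs_of_pos (Real.exp_pos _), h1, Real.exp_nat_mul]
    have h2 := decayWeight_pos v t
    calc _ ≤ (v ^ 2 * decayWeight v t) ^ m := by
          gcongr
          exact exp_neg_sqrt_two_mul_dv_le hv0 t
      _ = v ^ (2 * m) * decayWeight v t ^ m := by rw [mul_pow, pow_mul]
      _ ≤ v ^ (2 * m) * decayWeight v t ^ 1 := by
          refine mul_le_mul_of_nonneg_left ?_ (by positivity)
          exact pow_le_pow_of_le_one h2.le (decayWeight_le_one hv0 t) hm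
      _ = _ := by ring
  · filter_upwards [eventually_small_pos one_pos] with v ⟨hv0, _⟩
    ext t
    have h := (hasDerivAt_dv hv0 t).const_mul ((m : ℝ) * Real.sqrt 2)
    rw [h.fun_neg.exp.deriv, (hasDerivAt_dv hv0 t).deriv]
    ring

section Exponential

variable {E : ℝ → ℝ → ℝ} {c K : ℝ}

lemma exp_neg_mul (hc : 0 ≤ c)
    (hE : ∀ᶠ v in nhdsWithin (0 : ℝ) (Set.Ioi 0), ContDiff ℝ (⊤ : ℕ∞) (E v))
    (hd : ∀ n, SymbolBound n (fun v _ => v) (fun v => _root_.deriv (E v)))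
    (hK : ∀ᶠ v in nhdsWithin (0 : ℝ) (Set.Ioi 0), ∀ t, -K ≤ E v t) (n : ℕ) :
    SymbolBound n (fun _ _ => 1) (fun v t => Real.exp (-c * E v t)) := by
  refine of_linear_ode (fun n => (hd n).const_mul (-c)) ?_ ⟨Real.exp (c * K), Real.exp_pos _, ?_⟩
    ?_ n
  · filter_upwards [hE] with v hv
    exact (contDiff_const.mul hv).exp
  · filter_upwards [hK] with v hv t
    rw [abs_of_pos (Real.exp_pos _), mul_one]
    refine Real.exp_le_exp.2 ?_
    nlinarith [hv t]
  · filter_upwards [hE] with v hv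
    ext t
    have h := ((hv.differentiable (by simp)) t).hasDerivAt.const_mul (-c)
    rw [h.exp.deriv]
    ring

lemma exp_neg_mul_sub_one (hc : 0 ≤ c) (hK0 : 0 ≤ K) (hE : ∀ n, SymbolBound n φ E)
    (hd : ∀ n, SymbolBound n (fun v _ => v) (fun v => _root_.deriv (E v)))
    (hK : ∀ᶠ v in nhdsWithin (0 : ℝ) (Set.Ioi 0), ∀ t, -K ≤ E v t) (n : ℕ) :
    SymbolBound n φ (fun v t => Real.exp (-c * E v t) - 1) := by
  have hX := exp_neg_mul hc (hE 0).contDiff hd hK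
  obtain ⟨C, hC, hdom⟩ := (hE 0).dominatedBy
  refine of_bootstrap ?_ ⟨Real.exp (c * K) * ((c + 1) * C), by positivity, ?_⟩ (fun n _ => ?_) n
  · filter_upwards [(hX 0).contDiff] with v hv
    exact hv.sub contDiff_const
  · filter_upwards [hK, hdom] with v hv hv' t
    refine (abs_exp_sub_one_le_mul_exp (M := c * K) (by positivity) ?_).trans ?_
    · nlinarith [hv t]
    · rw [abs_mul, abs_neg, abs_of_nonneg hc, mul_assoc (Real.exp _), mul_assoc (c + 1)]
      gcongr
      · linarith
      · exact hv' t
  · refine ((((hE (n + 1)).deriv.const_mul (-c)).mul (hX n)).congr ?_).mono one_pos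
      (.of_forall fun v t => by simp)
    filter_upwards [(hE 0).contDiff] with v hv
    ext t
    have h := ((hv.differentiable (by simp)) t).hasDerivAt.const_mul (-c)
    rw [(h.exp.sub_const 1).deriv]
    ring

end Exponential

section Excess

variable {r : ℝ → ℝ → ℝ} {n₁ n₂ : ℕ}

lemma deriv_excess (hn₁ : 1 ≤ n₁)
    (hr : ∀ n, SymbolBound n (fun v _ => v ^ n₁ * Real.log (1 / v) ^ n₂) r) (β : ℝ) (n : ℕ) :
    SymbolBound n (fun v _ => v) (fun v => _root_.deriv (excess r β v)) := by
  have h1 : SymbolBound n (fun v _ => v)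
      (fun v t => _root_.deriv (_root_.dv v) t * (_root_.lorentzPow β v t - 1)) := by
    refine ((deriv_dv n).mul (lorentzPow_sub_one β n)).mono one_pos ?_
    filter_upwards [eventually_small_pos one_pos] with v ⟨hv0, hv1⟩ t
    have : v ^ 2 ≤ 1 := by nlinarith
    nlinarith
  have h2 : SymbolBound n (fun v _ => v)
      (fun v t => _root_.dv v t * _root_.deriv (_root_.lorentzPow β v) t) := by
    refine ((dv n).mul (deriv_lorentzPow β n)).mono two_pos ?_
    filter_upwards [eventually_small_pos one_pos] with v ⟨hv0, hv1⟩ t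
    have := sq_mul_logWeight_mul_decayWeight_le hv0 hv1 t
    nlinarith
  have h3 : SymbolBound n (fun v _ => v)
      (fun v => _root_.deriv fun t => r v t * _root_.lorentzPow β v t) := by
    refine ((hr (n + 1)).mul (lorentzPow β (n + 1))).deriv.mono one_pos ?_
    filter_upwards [eventually_small_pos one_pos, eventually_pow_mul_log_pow_le_one hn₁ n₂]
      with v ⟨hv0, hv1⟩ hv t
    nlinarith
  refine ((h1.add h2).add h3).congr ?_
  filter_upwards [(dv 0).contDiff, (lorentzPow β 0).contDiff, (hr 0).contDiff] with v hd hl hr'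
  ext t
  have hd' := ((hd.differentiable (by simp)) t).hasDerivAt
  have hl' := ((hl.differentiable (by simp)) t).hasDerivAt
  have hrl := (((hr'.mul hl).differentiable (by simp)) t).hasDerivAt
  exact ((hd'.mul (hl'.sub_const 1)).add hrl).deriv

lemma neg_le_excess (hn₁ : 1 ≤ n₁)
    (hr : ∀ n, SymbolBound n (fun v _ => v ^ n₁ * Real.log (1 / v) ^ n₂) r) {β : ℝ} (hβ : β ≤ 0) :
    ∃ K, 0 ≤ K ∧ ∀ᶠ v in nhdsWithin (0 : ℝ) (Set.Ioi 0), ∀ t, -K ≤ excess r β v t := by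
  obtain ⟨C, hC, h⟩ := ((hr 0).mul (lorentzPow β 0)).dominatedBy
  refine ⟨C, hC.le, ?_⟩
  filter_upwards [h, eventually_small_pos (show (0 : ℝ) < 1 / 2 by norm_num),
    eventually_pow_mul_log_pow_le_one hn₁ n₂] with v hv ⟨hv0, hv1⟩ hv2 t
  obtain ⟨hg1, hg2⟩ := lorentz_mem hv0 hv1 t
  have h1 : 1 ≤ _root_.lorentzPow β v t :=
    Real.one_le_rpow_of_pos_of_le_one_of_nonpos (by linarith) hg2 hβ
  have h2 := mul_nonneg (dv_nonneg hv0 (by linarith) t) (sub_nonneg.2 h1)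
  have h3 := (neg_le_abs _).trans (hv t)
  rw [excess]
  nlinarith

lemma pfun (hn₁ : 1 ≤ n₁)
    (hr : ∀ n, SymbolBound n (fun v _ => v ^ n₁ * Real.log (1 / v) ^ n₂) r)
    {m₁ : ℕ} (hm₁ : 1 ≤ m₁) (m₂ : ℕ) (m₃ : ℤ)
    (hl : ∀ n, SymbolBound n φ (fun v t => _root_.lorentzPow ((m₃ : ℝ) / 2) v t - 1))
    (hE : ∀ n, SymbolBound n φ (excess r (-((m₂ : ℝ) / 2)))) (n : ℕ) :
    SymbolBound n (fun v t => v ^ (2 * m₁) * decayWeight v t * φ v t) (pfun r m₁ m₂ m₃) := by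
  have hβ : -((m₂ : ℝ) / 2) ≤ 0 := by
    have : (0 : ℝ) ≤ m₂ := Nat.cast_nonneg _
    linarith
  obtain ⟨K, hK0, hK⟩ := neg_le_excess hn₁ hr hβ
  have hd := deriv_excess hn₁ hr (-((m₂ : ℝ) / 2))
  have hc : 0 ≤ (m₁ : ℝ) * Real.sqrt 2 := by positivity
  refine ((exp_neg_dv hm₁ n).mul ((((hl n).mul
    (exp_neg_mul hc (hE 0).contDiff hd hK n)).mono one_pos (.of_forall fun v t => by simp)).add
      (exp_neg_mul_sub_one hc hK0 hE hd hK n))).congr ?_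
  filter_upwards [eventually_small_pos (show (0 : ℝ) < 1 / 2 by norm_num)] with v ⟨hv0, hv1⟩
  exact pfun_eq r m₁ m₂ m₃ hv0 hv1

end Excess

end SymbolBound

/-- Lemma 3.4: decay estimates for `p(v,t)` and its time derivatives. -/
theorem stmt14 (n₁ : ℕ) (hn₁ : 1 ≤ n₁) (n₂ : ℕ) (r : ℝ → ℝ → ℝ)
    (hrsmooth : ∀ v : ℝ, 0 < v → v < 1 → ContDiff ℝ (⊤ : ℕ∞) (r v))
    (hrbound : ∀ l : ℕ, ∃ C v₀ : ℝ, 0 < C ∧ 0 < v₀ ∧ ∀ v : ℝ, 0 < v → v < v₀ → ∀ t : ℝ,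
      |iteratedDeriv l (r v) t| ≤ C * v ^ (n₁ + l) * Real.log (1 / v) ^ n₂)
    (m₁ : ℕ) (hm₁ : 1 ≤ m₁) (m₂ : ℕ) (m₃ : ℤ) :
    -- (i) m₂ = m₃ = 0
    ((m₂ = 0 ∧ m₃ = 0) → ∀ l : ℕ, ∃ C v₀ : ℝ, 0 < C ∧ 0 < v₀ ∧
      ∀ v : ℝ, 0 < v → v < v₀ → ∀ t : ℝ,
        |iteratedDeriv l (pfun r m₁ m₂ m₃ v) t|
          ≤ C * v ^ (2 * m₁ + n₁ + l) * (Real.log (1 / v) + |t| * v) ^ n₂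
            * Real.exp (-(2 * Real.sqrt 2 * |t| * v))) ∧
    -- (ii) m₃ ≠ 0, m₂ = 0
    ((m₃ ≠ 0 ∧ m₂ = 0) → ∀ l : ℕ, ∃ C v₀ : ℝ, 0 < C ∧ 0 < v₀ ∧
      ∀ v : ℝ, 0 < v → v < v₀ → ∀ t : ℝ,
        |iteratedDeriv l (pfun r m₁ m₂ m₃ v) t|
          ≤ C * max (v ^ (2 * m₁ + 2 + l))
              (v ^ (2 * m₁ + n₁ + l) * (Real.log (1 / v) + |t| * v) ^ n₂)
            * Real.exp (-(2 * Real.sqrt 2 * |t| * v))) ∧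
    -- (iii) m₂ ≠ 0
    (m₂ ≠ 0 → ∀ l : ℕ, ∃ C v₀ : ℝ, 0 < C ∧ 0 < v₀ ∧
      ∀ v : ℝ, 0 < v → v < v₀ → ∀ t : ℝ,
        |iteratedDeriv l (pfun r m₁ m₂ m₃ v) t|
          ≤ C * max (v ^ (2 * m₁ + 2 + l) * (|t| * v + Real.log (1 / v)))
              (v ^ (2 * m₁ + n₁ + l) * (|t| * v + Real.log (1 / v)) ^ n₂)
            * Real.exp (-(2 * Real.sqrt 2 * |t| * v))) := by
  have hr : ∀ n, SymbolBound n (fun v _ => v ^ n₁ * Real.log (1 / v) ^ n₂) r := by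
    refine SymbolBound.of_forall_exists ?_ ?_ fun l => ?_
    · filter_upwards [eventually_small_pos (Real.exp_pos (-1))] with v ⟨hv0, hv1⟩ t
      have := (one_le_logWeight hv0 hv1 t).1
      positivity
    · filter_upwards [eventually_small_pos one_pos] with v ⟨hv0, hv1⟩
      exact hrsmooth v hv0 hv1
    · obtain ⟨C, v₀, hC, hv₀, h⟩ := hrbound l
      refine ⟨C, v₀, hC, hv₀, fun v h0 h1 t => (h v h0 h1 t).trans (le_of_eq ?_)⟩
      ring
  have hr' : ∀ n, SymbolBound n (fun v t => v ^ n₁ * logWeight v t ^ n₂) r := fun n => by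
    refine (hr n).mono one_pos ?_
    filter_upwards [eventually_small_pos (Real.exp_pos (-1))] with v ⟨hv0, hv1⟩ t
    obtain ⟨h1, h2⟩ := one_le_logWeight hv0 hv1 t
    rw [one_mul]
    gcongr
  have hzero : excess r (-(((0 : ℕ) : ℝ) / 2)) = r := by
    ext v t
    simp [excess, lorentzPow]
  refine ⟨?_, ?_, ?_⟩
  · rintro ⟨rfl, rfl⟩ l
    have hl : ∀ n, SymbolBound n (fun v t => v ^ n₁ * logWeight v t ^ n₂)
        (fun v t => lorentzPow (((0 : ℤ) : ℝ) / 2) v t - 1) := fun n => by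
      refine ((hr' n).const_mul 0).congr (.of_forall fun v => ?_)
      ext t
      simp [lorentzPow]
    obtain ⟨C, v₀, hC, hv₀, h⟩ :=
      (SymbolBound.pfun hn₁ hr hm₁ 0 0 hl (by rwa [hzero]) l).exists_bound
    refine ⟨C, v₀, hC, hv₀, fun v h0 h1 t => (h v h0 h1 t).trans (le_of_eq ?_)⟩
    rw [logWeight, decayWeight, add_comm (|t| * v)]
    ring
  · rintro ⟨-, rfl⟩ l
    obtain ⟨C, v₀, hC, hv₀, h⟩ := (SymbolBound.pfun hn₁ hr hm₁ 0 m₃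
      (φ := fun v t => max (v ^ 2) (v ^ n₁ * logWeight v t ^ n₂))
      (fun n => (SymbolBound.lorentzPow_sub_one _ n).mono one_pos
        (.of_forall fun v t => by simp))
      (fun n => by
        rw [hzero]
        exact (hr' n).mono one_pos (.of_forall fun v t => by simp)) l).exists_bound
    refine ⟨C, v₀, hC, hv₀, fun v h0 h1 t => (h v h0 h1 t).trans (le_of_eq ?_)⟩
    have hmax := mul_max_of_nonneg (v ^ 2) (v ^ n₁ * logWeight v t ^ n₂)
      (show 0 ≤ v ^ (2 * m₁ + l) by positivity)
    rw [show v ^ (2 * m₁ + 2 + l) = v ^ (2 * m₁ + l) * v ^ 2 by ring,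
      show v ^ (2 * m₁ + n₁ + l) * (Real.log (1 / v) + |t| * v) ^ n₂
        = v ^ (2 * m₁ + l) * (v ^ n₁ * logWeight v t ^ n₂) by
          rw [logWeight, add_comm (|t| * v)]; ring, ← hmax, decayWeight]
    ring
  · intro _ l
    obtain ⟨C, v₀, hC, hv₀, h⟩ := (SymbolBound.pfun hn₁ hr hm₁ m₂ m₃
      (φ := fun v t => max (v ^ 2 * logWeight v t) (v ^ n₁ * logWeight v t ^ n₂))
      (fun n => (SymbolBound.lorentzPow_sub_one _ n).mono one_pos (by
        filter_upwards [eventually_small_pos (Real.exp_pos (-1))] with v ⟨hv0, hv1⟩ t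
        obtain ⟨h1, h2⟩ := one_le_logWeight hv0 hv1 t
        rw [one_mul]
        exact le_max_of_le_left (le_mul_of_one_le_right (by positivity) (h1.trans h2))))
      (fun n => by
        refine (((SymbolBound.dv n).mul (SymbolBound.lorentzPow_sub_one _ n)).mono one_pos
          (.of_forall fun v t => ?_)).add (((hr' n).mul (SymbolBound.lorentzPow _ n)).mono one_pos
          (.of_forall fun v t => ?_))
        · rw [one_mul, mul_comm]
          exact le_max_left _ _
        · rw [one_mul, mul_one]
          exact le_max_right _ _) l).exists_bound
    refine ⟨C, v₀, hC, hv₀, fun v h0 h1 t => (h v h0 h1 t).trans (le_of_eq ?_)⟩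
    have hmax := mul_max_of_nonneg (v ^ 2 * logWeight v t) (v ^ n₁ * logWeight v t ^ n₂)
      (show 0 ≤ v ^ (2 * m₁ + l) by positivity)
    rw [show v ^ (2 * m₁ + 2 + l) * (|t| * v + Real.log (1 / v))
        = v ^ (2 * m₁ + l) * (v ^ 2 * logWeight v t) by rw [logWeight]; ring,
      show v ^ (2 * m₁ + n₁ + l) * (|t| * v + Real.log (1 / v)) ^ n₂
        = v ^ (2 * m₁ + l) * (v ^ n₁ * logWeight v t ^ n₂) by rw [logWeight]; ring,
      ← hmax, decayWeight]
    ring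

end
end

section
/- The function ξ(x) = x/(4√2) − e^{−2√2 x}/16 satisfies, for all x ∈ ℝ, −d²/dx² (ξ(x) H'_{0,1}(x)) + U''(H_{0,1}(x)) ξ(x) H'_{0,1}(x) = H'_{0,1}(x). -/
open MeasureTheory Filter

noncomputable section

/-- The kink of the φ⁶ model. -/
def H01 (x : ℝ) : ℝ := Real.exp (Real.sqrt 2 * x) / Real.sqrt (1 + Real.exp (2 * Real.sqrt 2 * x))

/-- The φ⁶ potential. -/
def Uphi (φ : ℝ) : ℝ := φ ^ 2 * (1 - φ ^ 2) ^ 2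

/-- The function ξ(x) = x/(4√2) − e^{−2√2 x}/16. -/
def xiFun (x : ℝ) : ℝ := x / (4 * Real.sqrt 2) - Real.exp (-(2 * Real.sqrt 2 * x)) / 16

theorem H01_sq_mul (x : ℝ) : H01 x ^ 2 * (1 + Real.exp (-(2 * Real.sqrt 2 * x))) = 1 := by
  have hE : 0 < Real.exp (2 * Real.sqrt 2 * x) := Real.exp_pos _
  have h1 : Real.exp (Real.sqrt 2 * x) ^ 2 = Real.exp (2 * Real.sqrt 2 * x) := by
    rw [← Real.exp_nat_mul]
    congr 1
    push_cast
    ring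
  rw [H01, div_pow, Real.sq_sqrt (by positivity), h1, Real.exp_neg]
  field_simp
  ring

theorem hasDerivAt_H01 (x : ℝ) :
    HasDerivAt H01 (Real.sqrt 2 * (H01 x - H01 x ^ 3)) x := by
  have hE : 0 < 1 + Real.exp (2 * Real.sqrt 2 * x) := by positivity
  have hr : 0 < Real.sqrt (1 + Real.exp (2 * Real.sqrt 2 * x)) := Real.sqrt_pos.2 hE
  have h1 : Real.exp (2 * Real.sqrt 2 * x) = Real.exp (Real.sqrt 2 * x) ^ 2 := by
    rw [← Real.exp_nat_mul]
    congr 1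
    push_cast
    ring
  have hnum := ((hasDerivAt_id x).const_mul (Real.sqrt 2)).exp
  have hden := ((((hasDerivAt_id x).const_mul (2 * Real.sqrt 2)).exp).const_add 1).sqrt hE.ne'
  have h := hnum.div hden hr.ne'
  refine h.congr_deriv ?_
  simp only [H01, id]
  set r := Real.sqrt (1 + Real.exp (2 * Real.sqrt 2 * x))
  rw [h1]
  field_simp

theorem hasDerivAt_exp_neg_mul (x : ℝ) :
    HasDerivAt (fun y => Real.exp (-(2 * Real.sqrt 2 * y)))
      (-(2 * Real.sqrt 2) * Real.exp (-(2 * Real.sqrt 2 * x))) x := by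
  refine (((hasDerivAt_id x).const_mul (2 * Real.sqrt 2)).neg.exp).congr_deriv ?_
  simp only [id, Pi.neg_apply]
  ring

theorem hasDerivAt_xiFun (x : ℝ) :
    HasDerivAt xiFun (Real.sqrt 2 / 8 * (1 + Real.exp (-(2 * Real.sqrt 2 * x)))) x := by
  refine (((hasDerivAt_id x).div_const (4 * Real.sqrt 2)).sub
    ((hasDerivAt_exp_neg_mul x).div_const 16)).congr_deriv ?_
  have hs : Real.sqrt 2 ^ 2 = 2 := Real.sq_sqrt (by norm_num)
  field_simp
  linear_combination (-64) * hs

theorem iteratedDeriv_two_Uphi (φ : ℝ) :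
    iteratedDeriv 2 Uphi φ = 2 - 24 * φ ^ 2 + 30 * φ ^ 4 := by
  have h1 : deriv Uphi = fun φ => 2 * φ - 8 * φ ^ 3 + 6 * φ ^ 5 := by
    funext φ
    refine HasDerivAt.deriv ?_
    refine ((hasDerivAt_pow 2 φ).mul
      (((hasDerivAt_pow 2 φ).const_sub 1).pow 2)).congr_deriv ?_
    push_cast
    simp only [Pi.pow_apply]
    ring
  rw [iteratedDeriv_succ, iteratedDeriv_one, h1]
  refine HasDerivAt.deriv ?_
  refine ((((hasDerivAt_id φ).const_mul 2).sub ((hasDerivAt_pow 3 φ).const_mul 8)).add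
    ((hasDerivAt_pow 5 φ).const_mul 6)).congr_deriv ?_
  push_cast
  ring

theorem hasDerivAt_H01_sub_cube (x : ℝ) :
    HasDerivAt (fun y => H01 y - H01 y ^ 3)
      ((1 - 3 * H01 x ^ 2) * (Real.sqrt 2 * (H01 x - H01 x ^ 3))) x := by
  refine ((hasDerivAt_H01 x).sub ((hasDerivAt_H01 x).pow 3)).congr_deriv ?_
  push_cast
  ring

/-- ξ·H'_{0,1} solves L(ξ H') = H' for the linearized operator L = −d²/dx² + U''(H_{0,1}). -/
theorem stmt18 (x : ℝ) :
    -iteratedDeriv 2 (fun y => xiFun y * deriv H01 y) x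
      + iteratedDeriv 2 Uphi (H01 x) * (xiFun x * deriv H01 x)
      = deriv H01 x := by
  have hs : Real.sqrt 2 ^ 2 = 2 := Real.sq_sqrt (by norm_num)
  have hH : deriv H01 = fun y => Real.sqrt 2 * (H01 y - H01 y ^ 3) :=
    funext fun y => (hasDerivAt_H01 y).deriv
  have hf : deriv (fun y => xiFun y * (Real.sqrt 2 * (H01 y - H01 y ^ 3))) = fun y =>
      (1 + Real.exp (-(2 * Real.sqrt 2 * y))) / 4 * (H01 y - H01 y ^ 3)
        + xiFun y * (2 * ((1 - 3 * H01 y ^ 2) * (H01 y - H01 y ^ 3))) := by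
    funext y
    refine HasDerivAt.deriv (((hasDerivAt_xiFun y).mul
      ((hasDerivAt_H01_sub_cube y).const_mul (Real.sqrt 2))).congr_deriv ?_)
    linear_combination ((1 + Real.exp (-(2 * Real.sqrt 2 * y))) / 8 * (H01 y - H01 y ^ 3)
      + xiFun y * ((1 - 3 * H01 y ^ 2) * (H01 y - H01 y ^ 3))) * hs
  have hK := hasDerivAt_H01_sub_cube x
  have hf' := (((((hasDerivAt_exp_neg_mul x).const_add 1).div_const 4).mul hK).add
    ((hasDerivAt_xiFun x).mul
      ((((((hasDerivAt_H01 x).pow 2).const_mul 3).const_sub 1).mul hK).const_mul 2))).deriv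
  rw [iteratedDeriv_two_Uphi, iteratedDeriv_succ, iteratedDeriv_one, hH, hf]
  refine (congrArg (fun t => -t + _) hf').trans ?_
  have hw := H01_sq_mul x
  simp only [Pi.pow_apply, Pi.mul_apply]
  push_cast
  generalize Real.exp (-(2 * Real.sqrt 2 * x)) = w at *
  generalize H01 x = h at *
  linear_combination (3 / 2 * Real.sqrt 2 * (h - h ^ 3)) * hw

end
end
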